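/- Suppose that A_0, …, A_{k-1} is a finite collection of computably enumerable reals, none of which is K-trivial. Then for every constant c there exists n such that K(A_i↾n) > K(n) + c for all i < k. -/

import Mathlib

open Part Filter

open scoped Classical

namespace KPaper

/-- Binary strings. -/
abbrev Str := List Bool

/-! ### Oracle (Turing) reducibility -/

/-- The functions `ℕ →. ℕ` that are partial recursive relative to an oracle `O : ℕ →. ℕ`.
This mirrors Mathlib's `Nat.Partrec`, with an extra base case for the oracle. -/
inductive RecursiveIn (O : ℕ →. ℕ) : (ℕ →. ℕ) → Prop
  | oracle : RecursiveIn O O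
  | zero : RecursiveIn O (pure 0)
  | succ : RecursiveIn O ↑Nat.succ
  | left : RecursiveIn O ↑fun n : ℕ => n.unpair.1
  | right : RecursiveIn O ↑fun n : ℕ => n.unpair.2
  | pair {f g} : RecursiveIn O f → RecursiveIn O g →
      RecursiveIn O fun n => Nat.pair <$> f n <*> g n
  | comp {f g} : RecursiveIn O f → RecursiveIn O g → RecursiveIn O fun n => g n >>= f
  | prec {f g} : RecursiveIn O f → RecursiveIn O g → RecursiveIn O (Nat.unpaired fun a n =>
      n.rec (f a) fun y IH => do let i ← IH; g (Nat.pair a (Nat.pair y i)))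
  | rfind {f} : RecursiveIn O f →
      RecursiveIn O fun a => Nat.rfind fun n => (fun m => m = 0) <$> f (Nat.pair a n)

/-- The characteristic (partial) function of a set of naturals, used as a Turing oracle. -/
noncomputable def chi (A : Set ℕ) : ℕ →. ℕ := fun n => Part.some (if n ∈ A then 1 else 0)

/-- The characteristic function of an infinite binary sequence, used as a Turing oracle. -/
def chiSeq (X : ℕ → Bool) : ℕ →. ℕ := fun n => Part.some (cond (X n) 1 0)

/-- `A` is Turing reducible to `B`. -/
noncomputable def TuringLeSet (A B : Set ℕ) : Prop := RecursiveIn (chi B) (chi A)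

/-- `A` is Turing equivalent to `B`. -/
noncomputable def TuringEquivSet (A B : Set ℕ) : Prop := TuringLeSet A B ∧ TuringLeSet B A

/-- Turing equivalence between a set and an infinite binary sequence. -/
noncomputable def TuringEquivSetSeq (A : Set ℕ) (X : ℕ → Bool) : Prop :=
  RecursiveIn (chiSeq X) (chi A) ∧ RecursiveIn (chi A) (chiSeq X)

/-- The halting problem `∅'`. -/
def haltingSet : Set ℕ := {n | ((Denumerable.ofNat Nat.Partrec.Code n).eval n).Dom}

/-- A set of naturals is computably enumerable iff it is the domain of a
partial computable function. -/
def CESet (A : Set ℕ) : Prop := ∃ f : ℕ →. ℕ, Nat.Partrec f ∧ ∀ n, n ∈ A ↔ (f n).Dom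

/-! ### Machines and Kolmogorov complexity -/

/-- A (plain) machine is a partial computable map from binary strings to binary strings. -/
def PlainMachine (M : Str →. Str) : Prop := Partrec M

/-- A prefix-free machine: a partial computable map on binary strings whose
domain is an antichain under the prefix relation. -/
def PFMachine (M : Str →. Str) : Prop :=
  Partrec M ∧ ∀ ρ₁ ρ₂ : Str, (M ρ₁).Dom → (M ρ₂).Dom → ρ₁ <+: ρ₂ → ρ₁ = ρ₂

/-- The Kolmogorov complexity of a string `σ` with respect to a machine `M`:
the least length of an `M`-description of `σ` (`⊤` if there is none). -/
noncomputable def KC (M : Str →. Str) (σ : Str) : ℕ∞ :=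
  ⨅ ρ : {ρ : Str // σ ∈ M ρ}, ((ρ : Str).length : ℕ∞)

/-- An optimal prefix-free machine: a prefix-free machine whose associated complexity
is minimal, up to an additive constant, among all prefix-free machines. -/
def OptimalPF (U : Str →. Str) : Prop :=
  PFMachine U ∧ ∀ M : Str →. Str, PFMachine M → ∃ c : ℕ, ∀ σ : Str, KC U σ ≤ KC M σ + c

/-- An optimal plain machine. -/
def OptimalPlain (V : Str →. Str) : Prop :=
  PlainMachine V ∧ ∀ M : Str →. Str, PlainMachine M → ∃ c : ℕ, ∀ σ : Str, KC V σ ≤ KC M σ + c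

/-! ### Initial segments -/

/-- The first `n` bits of the characteristic sequence of a set of naturals. -/
noncomputable def restrSet (A : Set ℕ) (n : ℕ) : Str :=
  (List.range n).map fun i => decide (i ∈ A)

/-- The first `n` bits of an infinite binary sequence. -/
def restrSeq (X : ℕ → Bool) (n : ℕ) : Str := (List.range n).map X

/-- The string `0^n`; `K(n)` is identified with `K(0^n)`. -/
def zeroStr (n : ℕ) : Str := List.replicate n false

/-! ### `≤_K`, `<_K`, `K`-triviality (and the `≤_C` analogues) -/

def KLeSet (U : Str →. Str) (A B : Set ℕ) : Prop :=
  ∃ c : ℕ, ∀ n, KC U (restrSet A n) ≤ KC U (restrSet B n) + c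

def KLtSet (U : Str →. Str) (A B : Set ℕ) : Prop := KLeSet U A B ∧ ¬ KLeSet U B A

def KTrivialSet (U : Str →. Str) (A : Set ℕ) : Prop :=
  ∃ c : ℕ, ∀ n, KC U (restrSet A n) ≤ KC U (zeroStr n) + c

def KLeSeq (U : Str →. Str) (X Y : ℕ → Bool) : Prop :=
  ∃ c : ℕ, ∀ n, KC U (restrSeq X n) ≤ KC U (restrSeq Y n) + c

def KLtSeq (U : Str →. Str) (X Y : ℕ → Bool) : Prop := KLeSeq U X Y ∧ ¬ KLeSeq U Y X

def KTrivialSeq (U : Str →. Str) (X : ℕ → Bool) : Prop :=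
  ∃ c : ℕ, ∀ n, KC U (restrSeq X n) ≤ KC U (zeroStr n) + c

/-! ### Computably enumerable reals -/

/-- The real number in `[0,1]` whose binary expansion is the sequence `X`. -/
noncomputable def realOfSeq (X : ℕ → Bool) : ℝ := ∑' i : ℕ, cond (X i) ((2 : ℝ) ^ (i + 1))⁻¹ 0

/-- `X` (identified with the real it is the binary expansion of) is a computably
enumerable real: it is the limit of a nondecreasing computable sequence of
(dyadic) rationals. -/
def CEReal (X : ℕ → Bool) : Prop :=
  ∃ f : ℕ → ℤ, Computable f ∧
    (∀ s, (f s : ℝ) / 2 ^ s ≤ (f (s + 1) : ℝ) / 2 ^ (s + 1)) ∧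
    Tendsto (fun s => (f s : ℝ) / 2 ^ s) atTop (nhds (realOfSeq X))

/-- The characteristic sequence of a set of naturals. -/
noncomputable def seqOfSet (A : Set ℕ) : ℕ → Bool := fun i => decide (i ∈ A)

/-! ### Solovay reducibility -/

/-- Solovay reducibility on c.e. reals: `X ≤_S Y` iff there are nondecreasing computable
rational approximations to `X` and `Y` and a constant `c` such that at each stage the
distance to `X` is bounded by `c` times the distance to `Y`. -/
def SolovayLe (X Y : ℕ → Bool) : Prop :=
  ∃ (c : ℕ) (f g : ℕ → ℤ), Computable f ∧ Computable g ∧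
    (∀ s, (f s : ℝ) / 2 ^ s ≤ (f (s + 1) : ℝ) / 2 ^ (s + 1)) ∧
    (∀ s, (g s : ℝ) / 2 ^ s ≤ (g (s + 1) : ℝ) / 2 ^ (s + 1)) ∧
    Tendsto (fun s => (f s : ℝ) / 2 ^ s) atTop (nhds (realOfSeq X)) ∧
    Tendsto (fun s => (g s : ℝ) / 2 ^ s) atTop (nhds (realOfSeq Y)) ∧
    ∀ s, realOfSeq X - (f s : ℝ) / 2 ^ s ≤ (c : ℝ) * (realOfSeq Y - (g s : ℝ) / 2 ^ s)


section P1

/-- weight of a request -/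
noncomputable def hp (r : ℕ) : ℝ := (1 / 2 : ℝ) ^ r

lemma hp_pos (r : ℕ) : 0 < hp r := by unfold hp; positivity
lemma hp_nonneg (r : ℕ) : 0 ≤ hp r := (hp_pos r).le
lemma hp_add (r s : ℕ) : hp (r + s) = hp r * hp s := pow_add _ _ _
lemma hp_zero : hp 0 = 1 := pow_zero _
lemma hp_succ (r : ℕ) : hp (r + 1) = hp r / 2 := by unfold hp; rw [pow_succ]; ring
lemma hp_mul_pow (r : ℕ) : hp r * 2 ^ r = 1 := by
  unfold hp; rw [← mul_pow]; norm_num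
lemma hp_le_one (r : ℕ) : hp r ≤ 1 := pow_le_one₀ (by norm_num) (by norm_num)
lemma hp_anti {r s : ℕ} (h : r ≤ s) : hp s ≤ hp r :=
  pow_le_pow_of_le_one (by norm_num) (by norm_num) h

noncomputable def wt : Option (ℕ × Str) → ℝ
  | Option.none => 0
  | Option.some p => hp p.1

/-- value of a bit string -/
def val (ρ : Str) : ℕ := ρ.foldl (fun x b => 2 * x + cond b 1 0) 0

lemma val_foldl (τ : Str) (x : ℕ) :
    τ.foldl (fun x b => 2 * x + cond b 1 0) x = x * 2 ^ τ.length + val τ := by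
  induction τ generalizing x with
  | nil => simp [val]
  | cons b τ ih =>
    have := ih (2 * 0 + cond b 1 0)
    simp only [val, List.foldl_cons, List.length_cons] at *
    rw [ih, this, pow_succ]; ring

lemma val_append (ρ τ : Str) : val (ρ ++ τ) = val ρ * 2 ^ τ.length + val τ := by
  conv_lhs => rw [val, List.foldl_append]
  rw [val_foldl]; rfl

lemma val_lt (τ : Str) : val τ < 2 ^ τ.length := by
  induction τ using List.reverseRecOn with
  | nil => simp [val]
  | append_singleton l b ih =>
    rw [val_append]
    have : val [b] ≤ 1 := by cases b <;> simp [val]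
    simp [pow_succ]; omega

lemma exists_val (L v : ℕ) (h : v < 2 ^ L) : ∃ ρ : Str, ρ.length = L ∧ val ρ = v := by
  induction L generalizing v with
  | zero => exact ⟨[], rfl, by simp at h; simp [val, h]⟩
  | succ L ih =>
    obtain ⟨ρ, h1, h2⟩ := ih (v / 2) (by rw [pow_succ] at h; omega)
    refine ⟨ρ ++ [decide (v % 2 = 1)], by simp [h1], ?_⟩
    rw [val_append, h2]
    by_cases hv : v % 2 = 1
    · simp [hv, val]; omega
    · simp [hv, val]; omega

lemma val_primrec : Primrec val := by
  unfold val
  refine Primrec.list_foldl (f := fun ρ : Str => ρ) (g := fun _ => 0) (h := fun _ p => 2 * p.1 + cond p.2 1 0) Primrec.id (Primrec.const 0) ?_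
  have h1 : Primrec fun p : Str × (ℕ × Bool) => p.2.1 := Primrec.fst.comp Primrec.snd
  have h2 : Primrec fun p : Str × (ℕ × Bool) => p.2.2 := Primrec.snd.comp Primrec.snd
  exact Primrec.nat_add.comp (Primrec.nat_mul.comp (Primrec.const 2) h1)
    (Primrec.cond h2 (Primrec.const 1) (Primrec.const 0))

lemma pow2_primrec : Primrec (fun n : ℕ => 2 ^ n) := by
  have : Primrec (fun n : ℕ => Nat.rec (motive := fun _ => ℕ) 1 (fun _ y => 2 * y) n) :=
    Primrec.nat_rec' Primrec.id (Primrec.const 1)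
      (Primrec.to₂ (Primrec.nat_mul.comp (Primrec.const 2) (Primrec.snd.comp Primrec.snd)))
  refine this.of_eq ?_
  intro n
  induction n with
  | zero => rfl
  | succ n ih => simp only [] at ih ⊢; rw [ih, pow_succ]; ring

/-- running sums -/
def accStep (p : ℕ × ℕ) (o : Option (ℕ × Str)) : ℕ × ℕ :=
  match o with
  | Option.none => p
  | Option.some q => (p.1 * 2 ^ q.1 + 2 ^ p.2, p.2 + q.1)

def acc (R : ℕ → Option (ℕ × Str)) : ℕ → ℕ × ℕ
  | 0 => (0, 0)
  | m + 1 => accStep (acc R m) (R m)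

lemma acc_val (R : ℕ → Option (ℕ × Str)) (m : ℕ) :
    ((acc R m).1 : ℝ) * hp (acc R m).2 = ∑ i ∈ Finset.range m, wt (R i) := by
  induction m with
  | zero => simp [acc]
  | succ m ih =>
    rw [Finset.sum_range_succ, ← ih, acc]
    rcases R m with _ | ⟨r, σ⟩
    · simp [wt, accStep]
    · simp only [wt, hp_add, accStep]
      push_cast
      have h1 := hp_mul_pow r
      have h2 := hp_mul_pow (acc R m).2
      linear_combination ((acc R m).1 : ℝ) * hp (acc R m).2 * h1 + hp r * h2

lemma acc_computable {R : ℕ → Option (ℕ × Str)} (hR : Computable R) : Computable (acc R) := by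
  have hs : Computable₂ accStep := by
    have h : Computable fun x : (ℕ × ℕ) × Option (ℕ × Str) =>
        Option.casesOn (motive := fun _ => ℕ × ℕ) x.2 x.1
          (fun q => (x.1.1 * 2 ^ q.1 + 2 ^ x.1.2, x.1.2 + q.1)) := by
      refine Computable.option_casesOn Computable.snd Computable.fst ?_
      refine Primrec.to_comp ?_
      have a1 : Primrec fun p : ((ℕ × ℕ) × Option (ℕ × Str)) × (ℕ × Str) => p.1.1.1 :=
        Primrec.fst.comp (Primrec.fst.comp Primrec.fst)
      have a2 : Primrec fun p : ((ℕ × ℕ) × Option (ℕ × Str)) × (ℕ × Str) => p.1.1.2 :=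
        Primrec.snd.comp (Primrec.fst.comp Primrec.fst)
      have a3 : Primrec fun p : ((ℕ × ℕ) × Option (ℕ × Str)) × (ℕ × Str) => p.2.1 :=
        Primrec.fst.comp Primrec.snd
      exact Primrec.pair (Primrec.nat_add.comp (Primrec.nat_mul.comp a1 (pow2_primrec.comp a3))
        (pow2_primrec.comp a2)) (Primrec.nat_add.comp a2 a3)
    refine h.of_eq ?_
    rintro ⟨p, _ | q⟩ <;> rfl
  have : Computable (fun n : ℕ => Nat.rec (motive := fun _ => ℕ × ℕ) (0, 0)
      (fun m y => accStep y (R m)) n) := by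
    refine Computable.nat_rec (f := fun n : ℕ => n) (g := fun _ => ((0, 0) : ℕ × ℕ)) (h := fun _ p => accStep p.2 (R p.1)) Computable.id (Computable.const _) ?_
    exact hs.comp (Computable.snd.comp Computable.snd)
      (hR.comp (Computable.fst.comp Computable.snd))
  refine this.of_eq ?_
  intro n
  induction n with
  | zero => rfl
  | succ n ih => simp only [acc] at ih ⊢; rw [ih]

/-- ceiling codeword value -/
def cv (p : ℕ × ℕ) (r : ℕ) : ℕ := (p.1 * 2 ^ (r + 1) + 2 ^ p.2 - 1) / 2 ^ p.2

lemma cv_ge (p : ℕ × ℕ) (r : ℕ) : (p.1 : ℝ) * hp p.2 ≤ cv p r * hp (r + 1) := by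
  have h : p.1 * 2 ^ (r + 1) ≤ cv p r * 2 ^ p.2 := by
    unfold cv
    have hpos : 0 < 2 ^ p.2 := by positivity
    generalize 2 ^ p.2 = D at *
    generalize p.1 * 2 ^ (r + 1) = y at *
    have := Nat.div_add_mod (y + D - 1) D
    have := Nat.mod_lt (y + D - 1) hpos
    rw [mul_comm]; omega
  have h' : (p.1 : ℝ) * 2 ^ (r + 1) ≤ cv p r * 2 ^ p.2 := by exact_mod_cast h
  have := mul_le_mul_of_nonneg_right h' (mul_nonneg (hp_nonneg (r + 1)) (hp_nonneg p.2))
  have h1 := hp_mul_pow (r + 1)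
  have h2 := hp_mul_pow p.2
  calc (p.1 : ℝ) * hp p.2 = p.1 * 2 ^ (r + 1) * (hp (r + 1) * hp p.2) := by
        linear_combination (-(p.1 : ℝ) * hp p.2) * h1
    _ ≤ _ := this
    _ = _ := by linear_combination ((cv p r : ℝ) * hp (r + 1)) * h2

lemma cv_le (p : ℕ × ℕ) (r : ℕ) : ((cv p r : ℝ) + 1) * hp (r + 1) ≤ p.1 * hp p.2 + hp r := by
  have h : cv p r * 2 ^ p.2 ≤ p.1 * 2 ^ (r + 1) + 2 ^ p.2 := by
    unfold cv
    exact (Nat.div_mul_le_self _ _).trans (Nat.sub_le _ _)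
  have h' : (cv p r : ℝ) * 2 ^ p.2 ≤ p.1 * 2 ^ (r + 1) + 2 ^ p.2 := by exact_mod_cast h
  have := mul_le_mul_of_nonneg_right h' (mul_nonneg (hp_nonneg (r + 1)) (hp_nonneg p.2))
  have h1 := hp_mul_pow (r + 1)
  have h2 := hp_mul_pow p.2
  have h3 := hp_succ r
  have e1 : (cv p r : ℝ) * 2 ^ p.2 * (hp (r + 1) * hp p.2) = cv p r * hp (r + 1) := by
    linear_combination ((cv p r : ℝ) * hp (r + 1)) * h2
  have e2 : ((p.1 : ℝ) * 2 ^ (r + 1) + 2 ^ p.2) * (hp (r + 1) * hp p.2)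
      = p.1 * hp p.2 + hp (r + 1) := by
    linear_combination ((p.1 : ℝ) * hp p.2) * h1 + hp (r + 1) * h2
  rw [e1, e2] at this
  linarith

def kcTest (R : ℕ → Option (ℕ × Str)) (ρ : Str) (m : ℕ) : Option Str :=
  (R m).bind fun q => if ρ.length = q.1 + 1 ∧ val ρ = cv (acc R m) q.1 then Option.some q.2 else none

lemma kcTest_eq {R ρ m σ} : kcTest R ρ m = Option.some σ ↔
    ∃ r, R m = Option.some (r, σ) ∧ ρ.length = r + 1 ∧ val ρ = cv (acc R m) r := by
  unfold kcTest
  rcases hR : R m with _ | ⟨r, τ⟩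
  · simp
  · simp only [Option.bind_some, Option.ite_none_right_eq_some, Option.some.injEq, Prod.mk.injEq]
    constructor
    · rintro ⟨⟨h1, h2⟩, h3⟩; exact ⟨r, ⟨rfl, h3⟩, h1, h2⟩
    · rintro ⟨r', ⟨rfl, h3⟩, h1, h2⟩; exact ⟨⟨h1, h2⟩, h3⟩

lemma kcTest_computable {R : ℕ → Option (ℕ × Str)} (hR : Computable R) :
    Computable₂ (kcTest R) := by
  have hb : Primrec fun x : (Str × ℕ × ℕ) × (ℕ × Str) =>
      if x.1.1.length = x.2.1 + 1 ∧ val x.1.1 = cv x.1.2 x.2.1 then Option.some x.2.2 else Option.none := by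
    have a1 : Primrec fun x : (Str × ℕ × ℕ) × (ℕ × Str) => x.1.1 := Primrec.fst.comp Primrec.fst
    have a2 : Primrec fun x : (Str × ℕ × ℕ) × (ℕ × Str) => x.1.2.1 :=
      Primrec.fst.comp (Primrec.snd.comp Primrec.fst)
    have a3 : Primrec fun x : (Str × ℕ × ℕ) × (ℕ × Str) => 2 ^ x.1.2.2 :=
      pow2_primrec.comp (Primrec.snd.comp (Primrec.snd.comp Primrec.fst))
    have a4 : Primrec fun x : (Str × ℕ × ℕ) × (ℕ × Str) => x.2.1 + 1 :=
      Primrec.succ.comp (Primrec.fst.comp Primrec.snd)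
    refine Primrec.ite (PrimrecPred.and (Primrec.eq.comp (Primrec.list_length.comp a1) a4)
      (Primrec.eq.comp (val_primrec.comp a1) ?_))
      (Primrec.option_some.comp (Primrec.snd.comp Primrec.snd)) (Primrec.const Option.none)
    exact Primrec.nat_div.comp (Primrec.nat_sub.comp (Primrec.nat_add.comp
      (Primrec.nat_mul.comp a2 (pow2_primrec.comp a4)) a3) (Primrec.const 1)) a3
  have : Computable fun x : Str × ℕ => (R x.2).bind fun q =>
      if x.1.length = q.1 + 1 ∧ val x.1 = cv (acc R x.2) q.1 then Option.some q.2 else Option.none := by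
    refine Computable.option_bind (hR.comp Computable.snd) ?_
    have hq : Computable fun y : (Str × ℕ) × (ℕ × Str) => ((y.1.1, acc R y.1.2), y.2) :=
      Computable.pair (Computable.pair (Computable.fst.comp Computable.fst)
      ((acc_computable hR).comp (Computable.snd.comp Computable.fst))) Computable.snd
    have := hb.to_comp.comp hq
    exact this
  exact this

/-- **Kraft–Chaitin lemma** -/
theorem kc_lemma {U : Str →. Str} (hU : OptimalPF U) (R : ℕ → Option (ℕ × Str))
    (hR : Computable R) (hsum : ∀ N, ∑ i ∈ Finset.range N, wt (R i) ≤ 1) :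
    ∃ c : ℕ, ∀ m r σ, R m = Option.some (r, σ) → KC U σ ≤ (r : ℕ∞) + c := by
  let S : ℕ → ℝ := fun N => ∑ i ∈ Finset.range N, wt (R i)
  have hwt : ∀ o, 0 ≤ wt o := by
    rintro (_ | q)
    · exact le_rfl
    · exact hp_nonneg _
  have hSm : Monotone S := monotone_nat_of_le_succ fun n => by
    simp only [S, Finset.sum_range_succ]; linarith [hwt (R n)]
  have key : ∀ m r σ, R m = Option.some (r, σ) → S m ≤ cv (acc R m) r * hp (r + 1) ∧
      ((cv (acc R m) r : ℝ) + 1) * hp (r + 1) ≤ S (m + 1) := by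
    intro m r σ h
    have e : S (m + 1) = S m + hp r := by simp only [S, Finset.sum_range_succ, h, wt]
    refine ⟨?_, ?_⟩
    · have := cv_ge (acc R m) r
      rwa [acc_val] at this
    · have := cv_le (acc R m) r
      rw [acc_val] at this
      rw [e]; exact this
  have main : ∀ ρ₁ ρ₂ m₁ m₂ σ₁ σ₂, kcTest R ρ₁ m₁ = Option.some σ₁ → kcTest R ρ₂ m₂ = Option.some σ₂ →
      ρ₁ <+: ρ₂ → m₁ = m₂ := by
    rintro ρ₁ ρ₂ m₁ m₂ σ₁ σ₂ h1 h2 ⟨τ, rfl⟩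
    obtain ⟨r₁, hR1, hl1, hv1⟩ := kcTest_eq.1 h1
    obtain ⟨r₂, hR2, hl2, hv2⟩ := kcTest_eq.1 h2
    obtain ⟨k1, k1'⟩ := key _ _ _ hR1
    obtain ⟨k2, k2'⟩ := key _ _ _ hR2
    rw [← hv1, ← hl1] at k1 k1'
    rw [← hv2, ← hl2, val_append, List.length_append, hp_add] at k2 k2'
    have hτ : (val τ : ℝ) < 2 ^ τ.length := by exact_mod_cast val_lt τ
    have hτ0 : (0 : ℝ) ≤ val τ := Nat.cast_nonneg _
    have q := hp_mul_pow τ.length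
    have p1 := hp_pos ρ₁.length
    have p2 := hp_pos τ.length
    push_cast at k2 k2'
    have e : ∀ x : ℝ, ((val ρ₁ : ℝ) * 2 ^ τ.length + x) * (hp ρ₁.length * hp τ.length) =
        val ρ₁ * hp ρ₁.length + x * hp τ.length * hp ρ₁.length := by
      intro x; linear_combination ((val ρ₁ : ℝ) * hp ρ₁.length) * q
    rw [add_assoc] at k2'
    rw [e] at k2 k2'
    have b1 : (val τ : ℝ) * hp τ.length * hp ρ₁.length < hp ρ₁.length := by
      have : (val τ : ℝ) * hp τ.length < 1 := by rw [← q, mul_comm]; gcongr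
      nlinarith
    have b2 : 0 < ((val τ : ℝ) + 1) * hp τ.length * hp ρ₁.length := by positivity
    rcases lt_trichotomy m₁ m₂ with h | h | h
    · have := hSm (Nat.succ_le_of_lt h)
      simp only [Nat.succ_eq_add_one] at this
      nlinarith
    · exact h
    · have := hSm (Nat.succ_le_of_lt h)
      simp only [Nat.succ_eq_add_one] at this
      nlinarith
  let M : Str →. Str := fun ρ => Nat.rfindOpt (kcTest R ρ)
  have hMP : Partrec M := Partrec.rfindOpt (kcTest_computable hR)
  have hdom : ∀ ρ, (M ρ).Dom → ∃ m σ, kcTest R ρ m = Option.some σ := by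
    intro ρ h
    have := Nat.rfindOpt_dom.1 h
    simpa using this
  have hM : PFMachine M := by
    refine ⟨hMP, ?_⟩
    intro ρ₁ ρ₂ d1 d2 hp
    obtain ⟨m₁, σ₁, h1⟩ := hdom _ d1
    obtain ⟨m₂, σ₂, h2⟩ := hdom _ d2
    have := main _ _ _ _ _ _ h1 h2 hp
    subst this
    obtain ⟨r₁, hR1, hl1, hv1⟩ := kcTest_eq.1 h1
    obtain ⟨r₂, hR2, hl2, hv2⟩ := kcTest_eq.1 h2
    rw [hR1] at hR2
    simp only [Option.some.injEq, Prod.mk.injEq] at hR2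
    exact hp.eq_of_length (by rw [hl1, hl2, hR2.1])
  obtain ⟨c, hc⟩ := hU.2 M hM
  refine ⟨1 + c, ?_⟩
  intro m r σ h
  refine (hc σ).trans ?_
  have : KC M σ ≤ ((r + 1 : ℕ) : ℕ∞) := by
    have hv : cv (acc R m) r < 2 ^ (r + 1) := by
      have k := (key _ _ _ h).2.trans (hsum _)
      have q := hp_mul_pow (r + 1)
      have : ((cv (acc R m) r : ℝ) + 1) ≤ 2 ^ (r + 1) := by
        have := mul_le_mul_of_nonneg_right k (by positivity : (0 : ℝ) ≤ 2 ^ (r + 1))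
        rw [mul_assoc, q] at this; linarith
      have : cv (acc R m) r + 1 ≤ 2 ^ (r + 1) := by exact_mod_cast this
      omega
    obtain ⟨ρ, hl, hv⟩ := exists_val _ _ hv
    have ht : kcTest R ρ m = Option.some σ := kcTest_eq.2 ⟨r, h, hl, hv⟩
    have hd : (M ρ).Dom := Nat.rfindOpt_dom.2 ⟨m, σ, by simpa using ht⟩
    obtain ⟨m', hm'⟩ := Nat.rfindOpt_spec (Part.get_mem hd)
    have hm'' : kcTest R ρ m' = Option.some ((M ρ).get hd) := by simpa using hm'
    have e := main _ _ _ _ _ _ ht hm'' (List.prefix_refl _)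
    subst e
    rw [ht] at hm''
    have hmem : σ ∈ M ρ := by
      have := Part.get_mem hd
      simp only [Option.some.injEq] at hm''
      rwa [← hm''] at this
    have := iInf_le (fun ρ : {ρ : Str // σ ∈ M ρ} => ((ρ : Str).length : ℕ∞)) ⟨ρ, hmem⟩
    rw [← hl]; exact this
  calc KC M σ + c ≤ ((r + 1 : ℕ) : ℕ∞) + c := by gcongr
    _ = r + ((1 + c : ℕ) : ℕ∞) := by push_cast; ring

end P1

section P2

lemma kraft_prefixfree (F : Finset Str) (hF : ∀ x ∈ F, ∀ y ∈ F, x <+: y → x = y) :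
    ∑ w ∈ F, hp w.length ≤ 1 := by
  by_cases h0 : ([] : Str) ∈ F
  · have : F = {[]} := by
      ext x
      simp only [Finset.mem_singleton]
      constructor
      · intro hx; exact (hF _ h0 _ hx List.nil_prefix).symm
      · rintro rfl; exact h0
    rw [this]; simp [hp]
  · have hU : InformationTheory.UniquelyDecodable (F : Set Str) := by
      intro L₁
      induction L₁ with
      | nil =>
        intro L₂ _ h2 h
        cases L₂ with
        | nil => rfl
        | cons x L =>
          simp only [List.flatten_nil, List.flatten_cons] at h
          have : x = [] := by
            have := congrArg List.length h
            simp only [List.length_append, List.length_nil] at this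
            exact List.eq_nil_iff_length_eq_zero.2 (by omega)
          exact absurd (this ▸ h2 x (by simp)) h0
      | cons x L ih =>
        intro L₂ h1 h2 h
        cases L₂ with
        | nil =>
          simp only [List.flatten_nil, List.flatten_cons] at h
          have : x = [] := by
            have := congrArg List.length h
            simp only [List.length_append, List.length_nil] at this
            exact List.eq_nil_iff_length_eq_zero.2 (by omega)
          exact absurd (this ▸ h1 x (by simp)) h0
        | cons y L' =>
          simp only [List.flatten_cons] at h
          have hxy : x = y := by
            have hx : x ∈ F := h1 x (by simp)
            have hy : y ∈ F := h2 y (by simp)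
            have p1 : x <+: x ++ L.flatten := List.prefix_append _ _
            have p2 : y <+: x ++ L.flatten := h ▸ List.prefix_append _ _
            rcases List.prefix_or_prefix_of_prefix p1 p2 with q | q
            · exact hF _ hx _ hy q
            · exact (hF _ hy _ hx q).symm
          subst hxy
          rw [ih L' (fun w hw => h1 w (by simp [hw])) (fun w hw => h2 w (by simp [hw]))
            (List.append_cancel_left h)]
    have := InformationTheory.kraft_mcmillan_inequality hU
    simpa [hp] using this

/-- Abstract stage-wise presentation of an optimal prefix-free machine. -/
structure Pres (U : Str →. Str) (ev : ℕ → ℕ → Option Str) (len : ℕ → ℕ) : Prop where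
  pev : Primrec₂ ev
  plen : Primrec len
  mono : ∀ {s t e σ}, s ≤ t → ev s e = Option.some σ → ev t e = Option.some σ
  kraft : ∀ F : Finset ℕ, (∀ e ∈ F, ∃ s σ, ev s e = Option.some σ) → ∑ e ∈ F, hp (len e) ≤ 1
  kc : ∀ (σ : Str) (L : ℕ), KC U σ ≤ L → ∃ s e, ev s e = Option.some σ ∧ len e ≤ L
  kc' : ∀ (σ : Str) (s e : ℕ), ev s e = Option.some σ → KC U σ ≤ len e

lemma KC_le_iff (U : Str →. Str) (σ : Str) (L : ℕ) :
    KC U σ ≤ L ↔ ∃ ρ, σ ∈ U ρ ∧ ρ.length ≤ L := by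
  constructor
  · intro h
    by_contra hc
    push Not at hc
    have : ((L + 1 : ℕ) : ℕ∞) ≤ KC U σ := by
      refine le_iInf ?_
      rintro ⟨ρ, hρ⟩
      exact_mod_cast hc ρ hρ
    have := this.trans h
    have : L + 1 ≤ L := by exact_mod_cast this
    omega
  · rintro ⟨ρ, h1, h2⟩
    have := iInf_le (fun ρ : {ρ : Str // σ ∈ U ρ} => ((ρ : Str).length : ℕ∞)) ⟨ρ, h1⟩
    exact this.trans (by exact_mod_cast h2)

def lenC (e : ℕ) : ℕ := ((Encodable.decode e : Option Str).map List.length).getD 0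

def evC (c : Nat.Partrec.Code) (s e : ℕ) : Option Str :=
  (Encodable.decode e : Option Str).bind fun w =>
    if Encodable.encode w = e then (c.evaln s e).bind fun y => (Encodable.decode y : Option Str)
    else Option.none

theorem exists_pres (U : Str →. Str) (hU : PFMachine U) : ∃ ev len, Pres U ev len := by
  obtain ⟨c, hc⟩ := Nat.Partrec.Code.exists_code.1 hU.1
  have spec : ∀ s e σ, evC c s e = Option.some σ ↔
      ∃ w : Str, e = Encodable.encode w ∧ (Encodable.encode σ) ∈ c.evaln s e := by
    intro s e σ
    unfold evC
    rw [Option.bind_eq_some_iff]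
    constructor
    · rintro ⟨w, h1, h2⟩
      split_ifs at h2 with h3
      obtain ⟨y, h4, h5⟩ := Option.bind_eq_some_iff.1 h2
      refine ⟨w, h3.symm, ?_⟩
      have hy := Nat.Partrec.Code.evaln_sound (show y ∈ c.evaln s e from h4)
      rw [hc] at hy
      simp only [h1] at hy
      simp at hy
      obtain ⟨τ, _, h7⟩ := hy
      rw [← h7, Encodable.encodek] at h5
      simp only [Option.some.injEq] at h5
      subst h5
      rw [h7]; exact h4
    · rintro ⟨w, rfl, h⟩
      refine ⟨w, Encodable.encodek w, ?_⟩
      rw [if_pos rfl, Option.bind_eq_some_iff]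
      exact ⟨_, h, Encodable.encodek σ⟩
  have spec2 : ∀ (w : Str) σ, σ ∈ U w ↔ ∃ s, evC c s (Encodable.encode w) = Option.some σ := by
    intro w σ
    have : σ ∈ U w ↔ Encodable.encode σ ∈ c.eval (Encodable.encode w) := by
      rw [hc]; simp
    rw [this, Nat.Partrec.Code.evaln_complete]
    constructor
    · rintro ⟨s, h⟩; exact ⟨s, (spec _ _ _).2 ⟨w, rfl, h⟩⟩
    · rintro ⟨s, h⟩
      obtain ⟨_, _, h⟩ := (spec _ _ _).1 h
      exact ⟨s, h⟩
  have hlen : ∀ w : Str, lenC (Encodable.encode w) = w.length := by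
    intro w; simp [lenC]
  refine ⟨evC c, lenC, ?_, ?_, ?_, ?_, ?_, ?_⟩
  · refine Primrec.option_bind (f := fun x : ℕ × ℕ => (Encodable.decode x.2 : Option Str))
      (g := fun x w => if Encodable.encode w = x.2 then (c.evaln x.1 x.2).bind
        fun y => (Encodable.decode y : Option Str) else Option.none)
      (Primrec.decode.comp Primrec.snd) ?_
    have h2 : Primrec fun x : (ℕ × ℕ) × Str => x.1.2 := Primrec.snd.comp Primrec.fst
    have h1 : Primrec fun x : (ℕ × ℕ) × Str => x.1.1 := Primrec.fst.comp Primrec.fst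
    refine Primrec.ite (Primrec.eq.comp (Primrec.encode.comp Primrec.snd) h2)
      ?_ (Primrec.const Option.none)
    refine Primrec.option_bind (f := fun x : (ℕ × ℕ) × Str => c.evaln x.1.1 x.1.2)
      (g := fun _ y => (Encodable.decode y : Option Str)) ?_ ?_
    · exact Nat.Partrec.Code.primrec_evaln.comp (Primrec.pair (Primrec.pair h1 (Primrec.const c)) h2)
    · exact Primrec.decode.comp Primrec.snd
  · exact Primrec.option_getD.comp (Primrec.option_map Primrec.decode
      (Primrec.list_length.comp Primrec.snd)) (Primrec.const 0)
  · intro s t e σ hst h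
    obtain ⟨w, h1, h2⟩ := (spec _ _ _).1 h
    exact (spec _ _ _).2 ⟨w, h1, Nat.Partrec.Code.evaln_mono hst h2⟩
  · intro F hF
    have : ∀ e ∈ F, ∃ w : Str, e = Encodable.encode w ∧ (U w).Dom := by
      intro e he
      obtain ⟨s, σ, h⟩ := hF e he
      obtain ⟨w, rfl, _⟩ := (spec _ _ _).1 h
      have := (spec2 w σ).2 ⟨s, h⟩
      exact ⟨w, rfl, Part.dom_iff_mem.2 ⟨σ, this⟩⟩
    choose! W hW1 hW2 using this
    have e1 : ∑ e ∈ F, hp (lenC e) = ∑ w ∈ F.image W, hp w.length := by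
      rw [Finset.sum_image]
      · refine Finset.sum_congr rfl fun e he => ?_
        conv_lhs => rw [hW1 e he, hlen]
      · intro a ha b hb hab
        rw [hW1 a ha, hW1 b hb, hab]
    rw [e1]
    refine kraft_prefixfree _ ?_
    intro x hx y hy hxy
    obtain ⟨a, ha, rfl⟩ := Finset.mem_image.1 hx
    obtain ⟨b, hb, rfl⟩ := Finset.mem_image.1 hy
    exact hU.2 _ _ (hW2 a ha) (hW2 b hb) hxy
  · intro σ L h
    obtain ⟨ρ, h1, h2⟩ := (KC_le_iff U σ L).1 h
    obtain ⟨s, hs⟩ := (spec2 ρ σ).1 h1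
    exact ⟨s, _, hs, by rw [hlen]; exact h2⟩
  · intro σ s e h
    obtain ⟨w, rfl, _⟩ := (spec _ _ _).1 h
    rw [hlen]
    exact (KC_le_iff U σ _).2 ⟨w, (spec2 w σ).2 ⟨s, h⟩, le_rfl⟩

end P2

section P3

structure Approx (X : ℕ → Bool) (b : ℕ → ℕ → Str) : Prop where
  prim : Primrec₂ b
  sand : ∀ {t T s n}, t ≤ T → T ≤ s → b t n = b s n → b T n = b t n
  coh : ∀ {s t y n}, y ≤ n → b s n = b t n → b s y = b t y
  lim : ∀ n, ∃ s₀, ∀ s, s₀ ≤ s → b s n = restrSeq X n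
  length : ∀ s n, (b s n).length = n

lemma approx_of_const (X : ℕ → Bool) (N : ℕ) (v : Bool) (h : ∀ i, N ≤ i → X i = v) :
    ∃ b, Approx X b := by
  have hX : Primrec X := by
    have : Primrec fun i : ℕ => (restrSeq X N).getD i v :=
      (Primrec.list_getD v).comp (Primrec.const _) Primrec.id
    refine this.of_eq fun i => ?_
    by_cases hi : i < N
    · simp [restrSeq, List.getD, hi]
    · simp [restrSeq, List.getD, hi, h i (by omega)]
  refine ⟨fun _ n => restrSeq X n, ?_, ?_, ?_, ?_, ?_⟩
  · exact Primrec.list_map (f := fun x : ℕ × ℕ => List.range x.2) (g := fun _ i => X i)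
      (Primrec.list_range.comp Primrec.snd) (hX.comp Primrec.snd)
  · intros; rfl
  · intros; rfl
  · intro n; exact ⟨0, fun _ _ => rfl⟩
  · intro s n; simp [restrSeq]

/-- value of the first n bits -/
def preVal (X : ℕ → Bool) : ℕ → ℕ
  | 0 => 0
  | n + 1 => 2 * preVal X n + cond (X n) 1 0

lemma summable_seq (X : ℕ → Bool) :
    Summable fun i : ℕ => cond (X i) ((2 : ℝ) ^ (i + 1))⁻¹ 0 := by
  have h : Summable fun i : ℕ => (1 / 2 : ℝ) ^ (i + 1) :=
    (summable_nat_add_iff 1).2 summable_geometric_two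
  refine Summable.of_nonneg_of_le ?_ ?_ h
  · intro i; cases X i <;> simp
  · intro i; cases X i <;> simp

lemma preVal_sum (X : ℕ → Bool) (n : ℕ) :
    ∑ i ∈ Finset.range n, cond (X i) ((2 : ℝ) ^ (i + 1))⁻¹ 0 = preVal X n / 2 ^ n := by
  induction n with
  | zero => simp [preVal]
  | succ n ih =>
    rw [Finset.sum_range_succ, ih, preVal]
    cases X n
    · simp [pow_succ]; field_simp
    · simp [pow_succ]; field_simp

lemma realOfSeq_bounds (X : ℕ → Bool) (hX : ∀ N v, ∃ i, N ≤ i ∧ X i ≠ v) (n : ℕ) :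
    (preVal X n : ℝ) / 2 ^ n < realOfSeq X ∧ realOfSeq X < (preVal X n + 1 : ℝ) / 2 ^ n := by
  have hs := summable_seq X
  have key : ∀ m, (preVal X m : ℝ) / 2 ^ m ≤ realOfSeq X ∧
      realOfSeq X ≤ (preVal X m + 1 : ℝ) / 2 ^ m := by
    intro m
    have e := hs.sum_add_tsum_nat_add m
    rw [preVal_sum] at e
    have hs' := (summable_nat_add_iff m).2 hs
    have h0 : 0 ≤ ∑' i, cond (X (i + m)) ((2 : ℝ) ^ (i + m + 1))⁻¹ 0 :=
      tsum_nonneg fun i => by cases X (i + m) <;> simp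
    have h1 : ∑' i, cond (X (i + m)) ((2 : ℝ) ^ (i + m + 1))⁻¹ 0 ≤ 1 / 2 ^ m := by
      have hg : HasSum (fun i : ℕ => (1 / 2 ^ m * (1 / 2) : ℝ) * (1 / 2) ^ i) (1 / 2 ^ m * (1 / 2) * 2) :=
        hasSum_geometric_two.mul_left _
      have : ∑' i, cond (X (i + m)) ((2 : ℝ) ^ (i + m + 1))⁻¹ 0 ≤
          ∑' i : ℕ, (1 / 2 ^ m * (1 / 2) : ℝ) * (1 / 2) ^ i := by
        refine hs'.tsum_le_tsum ?_ hg.summable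
        intro i
        have e2 : ((2 : ℝ) ^ (i + m + 1))⁻¹ = (1 / 2 ^ m * (1 / 2) : ℝ) * (1 / 2) ^ i := by
          rw [pow_succ, pow_add, one_div_pow]; field_simp
        cases X (i + m)
        · simp only [cond_false]; positivity
        · simp only [cond_true]; exact e2.le
      rw [hg.tsum_eq] at this
      linarith
    have e' : realOfSeq X = preVal X m / 2 ^ m +
        ∑' i, cond (X (i + m)) ((2 : ℝ) ^ (i + m + 1))⁻¹ 0 := e.symm
    rw [e', add_div]
    constructor <;> linarith
  have lo : ∀ m, (preVal X n : ℝ) / 2 ^ n ≤ preVal X (n + m) / 2 ^ (n + m) := by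
    intro m
    induction m with
    | zero => simp
    | succ m ih =>
      refine ih.trans ?_
      rw [← add_assoc, preVal, pow_succ, div_le_div_iff₀ (by positivity) (by positivity)]
      have : (0 : ℝ) ≤ ((cond (X (n + m)) 1 0 : ℕ) : ℝ) := Nat.cast_nonneg _
      push_cast at this ⊢
      have h2 : (0 : ℝ) < 2 ^ (n + m) := by positivity
      nlinarith
  have hi : ∀ m, (preVal X (n + m) + 1 : ℝ) / 2 ^ (n + m) ≤ (preVal X n + 1 : ℝ) / 2 ^ n := by
    intro m
    induction m with
    | zero => simp
    | succ m ih =>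
      refine le_trans ?_ ih
      rw [← add_assoc, preVal, pow_succ, div_le_div_iff₀ (by positivity) (by positivity)]
      have : ((cond (X (n + m)) 1 0 : ℕ) : ℝ) ≤ 1 := by cases X (n + m) <;> simp
      push_cast at this ⊢
      have h2 : (0 : ℝ) < 2 ^ (n + m) := by positivity
      nlinarith
  constructor
  · obtain ⟨i, h1, h2⟩ := hX n false
    obtain ⟨m, rfl⟩ := Nat.exists_eq_add_of_le h1
    simp only [ne_eq, Bool.not_eq_false] at h2
    refine lt_of_lt_of_le ?_ (key (n + m + 1)).1
    refine (lo m).trans_lt ?_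
    rw [preVal, h2, pow_succ, div_lt_div_iff₀ (by positivity) (by positivity)]
    simp only [cond_true, cond_false]
    push_cast
    have h2 : (0 : ℝ) < 2 ^ (n + m) := by positivity
    nlinarith
  · obtain ⟨i, h1, h2⟩ := hX n true
    obtain ⟨m, rfl⟩ := Nat.exists_eq_add_of_le h1
    simp only [ne_eq, Bool.not_eq_true] at h2
    refine lt_of_le_of_lt (key (n + m + 1)).2 ?_
    refine lt_of_lt_of_le ?_ (hi m)
    rw [preVal, h2, pow_succ, div_lt_div_iff₀ (by positivity) (by positivity)]
    simp only [cond_true, cond_false]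
    push_cast
    have h2 : (0 : ℝ) < 2 ^ (n + m) := by positivity
    nlinarith

lemma approx_of_nat (X : ℕ → Bool) (hX : ∀ N v, ∃ i, N ≤ i ∧ X i ≠ v) (G D : ℕ → ℕ)
    (hG : Primrec G) (hD : Primrec D) (hm : Monotone fun s => (G s : ℝ) / 2 ^ D s)
    (hlim : Tendsto (fun s => (G s : ℝ) / 2 ^ D s) atTop (nhds (realOfSeq X))) :
    ∃ b, Approx X b := by
  let F : ℕ → ℕ → ℕ := fun s m => G s * 2 ^ m / 2 ^ D s
  have hFf : ∀ s m, F s m = ⌊(G s : ℝ) / 2 ^ D s * 2 ^ m⌋₊ := by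
    intro s m
    have := Nat.floor_div_eq_div (K := ℝ) (G s * 2 ^ m) (2 ^ D s)
    change G s * 2 ^ m / 2 ^ D s = _
    rw [← this]; congr 1; push_cast; ring
  have hFm : ∀ m {s t}, s ≤ t → F s m ≤ F t m := by
    intro m s t hst
    rw [hFf, hFf]
    exact Nat.floor_mono (mul_le_mul_of_nonneg_right (hm hst) (by positivity))
  have hzlt : ∀ s, (G s : ℝ) / 2 ^ D s < 1 := by
    intro s
    have h1 := hm.ge_of_tendsto hlim s
    have h2 := (realOfSeq_bounds X hX 0).2
    simp [preVal] at h2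
    exact lt_of_le_of_lt h1 h2
  have hF0 : ∀ s, F s 0 = 0 := by
    intro s
    rw [hFf]; simp; simpa using hzlt s
  have hFs : ∀ s m, F s m = F s (m + 1) / 2 := by
    intro s m
    simp only [F]
    rw [Nat.div_div_eq_div_mul, pow_succ, ← mul_assoc, Nat.mul_div_mul_right _ _ (by norm_num)]
  let b : ℕ → ℕ → Str := fun s n => (List.range n).map fun i => decide (F s (i + 1) % 2 = 1)
  have hbF : ∀ {s t n}, b s n = b t n ↔ ∀ m ≤ n, F s m = F t m := by
    intro s t n
    constructor
    · intro h m
      have h' : ∀ i < n, (F s (i + 1) % 2 = 1 ↔ F t (i + 1) % 2 = 1) := by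
        intro i hi
        have := List.map_inj_left.1 h i (by simpa using hi)
        simpa using this
      induction m with
      | zero => intro _; rw [hF0, hF0]
      | succ m ih =>
        intro hm
        have a1 := ih (by omega)
        have a2 := h' m (by omega)
        rw [hFs s, hFs t] at a1
        omega
    · intro h
      refine List.map_inj_left.2 ?_
      intro i hi
      simp at hi
      simp only [h (i + 1) (by omega)]
  have hFn : ∀ s t n, F s n = F t n → ∀ m ≤ n, F s m = F t m := by
    intro s t n h m hmn
    induction n with
    | zero => obtain rfl : m = 0 := by omega
              exact h
    | succ n ih =>
      rcases Nat.lt_or_ge n m with h1 | h1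
      · obtain rfl : m = n + 1 := by omega
        exact h
      · exact ih (by rw [hFs s, hFs t, h]) h1
  refine ⟨b, ?_, ?_, ?_, ?_, ?_⟩
  · refine Primrec.list_map (f := fun x : ℕ × ℕ => List.range x.2)
      (g := fun x i => decide (F x.1 (i + 1) % 2 = 1)) (Primrec.list_range.comp Primrec.snd) ?_
    have h1 : Primrec fun y : (ℕ × ℕ) × ℕ => y.1.1 := Primrec.fst.comp Primrec.fst
    have : PrimrecPred fun y : (ℕ × ℕ) × ℕ => F y.1.1 (y.2 + 1) % 2 = 1 := by
      refine Primrec.eq.comp (Primrec.nat_mod.comp ?_ (Primrec.const 2)) (Primrec.const 1)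
      exact Primrec.nat_div.comp (Primrec.nat_mul.comp (hG.comp h1)
        (pow2_primrec.comp (Primrec.succ.comp Primrec.snd))) (pow2_primrec.comp (hD.comp h1))
    exact this.decide
  · intro t T s n h1 h2 h
    refine hbF.2 (hFn _ _ _ ?_)
    have a := hbF.1 h n le_rfl
    have := hFm n h1
    have := hFm n h2
    omega
  · intro s t y n hy h
    exact hbF.2 fun m hm => hbF.1 h m (hm.trans hy)
  · intro n
    have ev : ∀ m, ∀ᶠ s in atTop, F s m = preVal X m := by
      intro m
      have h1 := realOfSeq_bounds X hX m
      filter_upwards [hlim.eventually (lt_mem_nhds h1.1)] with s hs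
      have h3 : (G s : ℝ) / 2 ^ D s < _ := lt_of_le_of_lt (hm.ge_of_tendsto hlim s) h1.2
      rw [hFf, Nat.floor_eq_iff (by positivity)]
      rw [div_lt_iff₀ (by positivity)] at hs
      rw [lt_div_iff₀ (by positivity)] at h3
      exact ⟨hs.le, h3⟩
    have ev' : ∀ᶠ s in atTop, ∀ m ∈ Finset.range (n + 1), F s m = preVal X m :=
      (Filter.eventually_all_finset _).2 fun m _ => ev m
    obtain ⟨s₀, h0⟩ := eventually_atTop.1 ev'
    refine ⟨s₀, fun s hs => ?_⟩
    refine List.map_inj_left.2 ?_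
    intro i hi
    have hi' : i < n := by simpa using hi
    have := h0 s hs (i + 1) (by simp; omega)
    rw [this, preVal]
    cases X i <;> simp
  · intro s n; simp [b]

lemma toNat_primrec : Primrec Int.toNat := by
  have : Primrec fun z : ℤ => bif (Encodable.encode z).bodd then 0 else (Encodable.encode z).div2 :=
    Primrec.cond (Primrec.nat_bodd.comp Primrec.encode) (Primrec.const 0)
      (Primrec.nat_div2.comp Primrec.encode)
  refine this.of_eq fun z => ?_
  rcases z with n | n
  · have : Encodable.encode (Int.ofNat n) = 2 * n := rfl
    rw [this]; simp
  · have : Encodable.encode (Int.negSucc n) = 2 * n + 1 := rfl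
    rw [this]; simp

lemma slow (g : ℕ → ℕ) (hg : Computable g) (x : ℝ) (hm : Monotone fun u => (g u : ℝ) / 2 ^ u)
    (hlim : Tendsto (fun u => (g u : ℝ) / 2 ^ u) atTop (nhds x)) :
    ∃ G D : ℕ → ℕ, Primrec G ∧ Primrec D ∧ (Monotone fun s => (G s : ℝ) / 2 ^ D s) ∧
      Tendsto (fun s => (G s : ℝ) / 2 ^ D s) atTop (nhds x) := by
  have hg' : Nat.Partrec (fun u => Part.some (g u)) := Partrec.nat_iff.1 hg
  obtain ⟨c, hc⟩ := Nat.Partrec.Code.exists_code.1 hg'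
  have hval : ∀ s u y, c.evaln s u = Option.some y → y = g u := by
    intro s u y h
    have := Nat.Partrec.Code.evaln_sound (show y ∈ c.evaln s u from h)
    rw [hc] at this
    simpa using this
  let P : ℕ → ℕ → Prop := fun s u => (c.evaln s u).isSome
  have hP : ∀ {s t u}, s ≤ t → P s u → P t u := by
    intro s t u hst h
    obtain ⟨y, hy⟩ := Option.isSome_iff_exists.1 h
    exact Option.isSome_iff_exists.2 ⟨y, Nat.Partrec.Code.evaln_mono hst hy⟩
  let D : ℕ → ℕ := fun s => Nat.findGreatest (P s) s
  let G : ℕ → ℕ := fun s => (c.evaln s (D s)).getD 0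
  have hev : Primrec₂ fun s u => c.evaln s u :=
    Nat.Partrec.Code.primrec_evaln.comp
      (Primrec.pair (Primrec.pair Primrec.fst (Primrec.const c)) Primrec.snd)
  have hD : Primrec D := by
    refine Primrec.nat_findGreatest Primrec.id ?_
    refine Primrec.primrecPred (p := fun x : ℕ × ℕ => P x.1 x.2) ?_
    refine (Primrec.option_isSome.comp hev).of_eq ?_
    rintro ⟨s, u⟩
    simp [P]
  have hG : Primrec G := Primrec.option_getD.comp (hev.comp Primrec.id hD) (Primrec.const 0)
  have hG1 : ∀ s, P s (D s) → (G s : ℝ) / 2 ^ D s = (g (D s) : ℝ) / 2 ^ D s := by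
    intro s h
    obtain ⟨y, hy⟩ := Option.isSome_iff_exists.1 h
    have := hval _ _ _ hy
    simp only [G, hy, Option.getD_some, this]
  have hG2 : ∀ s, ¬ P s (D s) → G s = 0 := by
    intro s h
    have : c.evaln s (D s) = Option.none := by simpa [P] using h
    simp only [G, this, Option.getD_none]
  refine ⟨G, D, hG, hD, ?_, ?_⟩
  · intro s t hst
    simp only
    by_cases h : P s (D s)
    · have hle : D s ≤ D t := Nat.le_findGreatest ((Nat.findGreatest_le _).trans hst) (hP hst h)
      have ht : P t (D t) := Nat.findGreatest_spec (P := P t) ((Nat.findGreatest_le s).trans hst)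
        (hP hst h)
      rw [hG1 s h, hG1 t ht]
      exact hm hle
    · rw [hG2 s h]; simp; positivity
  · have hu : ∀ u, ∃ s₀, ∀ s, s₀ ≤ s → P s (D s) ∧ u ≤ D s := by
      intro u
      have : g u ∈ c.eval u := by rw [hc]; simp
      obtain ⟨s₁, hs₁⟩ := Nat.Partrec.Code.evaln_complete.1 this
      refine ⟨max s₁ u, fun s hs => ?_⟩
      have hp : P s u := hP (le_trans (le_max_left _ _) hs) (Option.isSome_iff_exists.2 ⟨_, hs₁⟩)
      have hus : u ≤ s := le_trans (le_max_right _ _) hs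
      exact ⟨Nat.findGreatest_spec (P := P s) hus hp, Nat.le_findGreatest hus hp⟩
    have hDt : Tendsto D atTop atTop := by
      refine tendsto_atTop.2 fun u => ?_
      obtain ⟨s₀, h⟩ := hu u
      exact eventually_atTop.2 ⟨s₀, fun s hs => (h s hs).2⟩
    refine (hlim.comp hDt).congr' ?_
    obtain ⟨s₀, h⟩ := hu 0
    exact eventually_atTop.2 ⟨s₀, fun s hs => (hG1 s (h s hs).1).symm⟩

theorem exists_approx (X : ℕ → Bool) (h : CEReal X) : ∃ b, Approx X b := by
  by_cases hX : ∃ N v, ∀ i, N ≤ i → X i = v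
  · obtain ⟨N, v, h⟩ := hX
    exact approx_of_const X N v h
  · push Not at hX
    obtain ⟨f, hf, hm, hl⟩ := h
    have e : ∀ s, (((f s).toNat : ℕ) : ℝ) / 2 ^ s = max ((f s : ℝ) / 2 ^ s) 0 := by
      intro s
      have : (((f s).toNat : ℕ) : ℝ) = max (f s : ℝ) 0 := by
        have := Int.toNat_eq_max (f s)
        exact_mod_cast congrArg (Int.cast : ℤ → ℝ) this
      rw [this]
      have := max_div_div_right (α := ℝ) (c := 2 ^ s) (by positivity) (f s : ℝ) 0
      rw [← this, zero_div]
    obtain ⟨G, D, hG, hD, h1, h2⟩ := slow (fun u => (f u).toNat) (toNat_primrec.to_comp.comp hf)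
      (realOfSeq X) (by
        refine monotone_nat_of_le_succ fun s => ?_
        rw [e, e]
        exact max_le_max (hm s) le_rfl) (by
        simp only [e]
        have := hl.max (tendsto_const_nhds (x := (0 : ℝ)))
        rwa [max_eq_left] at this
        exact tsum_nonneg fun i => by cases X i <;> simp)
    exact approx_of_nat X hX G D hG hD h1 h2

/-- uniform version for finitely many sequences, indexed by ℕ -/
theorem exists_approx_fin (k : ℕ) (X : ℕ → ℕ → Bool) (h : ∀ i < k, CEReal (X i)) :
    ∃ b : ℕ → ℕ → ℕ → Str, (Primrec fun p : ℕ × ℕ × ℕ => b p.1 p.2.1 p.2.2) ∧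
      ∀ i < k, Approx (X i) (b i) := by
  induction k with
  | zero =>
    exact ⟨fun _ _ _ => [], Primrec.const _, fun i hi => absurd hi (by omega)⟩
  | succ k ih =>
    obtain ⟨b, hb, hb'⟩ := ih fun i hi => h i (by omega)
    obtain ⟨b', hb2⟩ := exists_approx (X k) (h k (by omega))
    refine ⟨fun i s n => if i = k then b' s n else b i s n, ?_, ?_⟩
    · exact Primrec.ite (Primrec.eq.comp Primrec.fst (Primrec.const k))
        (hb2.prim.comp (Primrec.fst.comp Primrec.snd) (Primrec.snd.comp Primrec.snd)) hb
    · intro i hi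
      by_cases hik : i = k
      · subst hik; simpa using hb2
      · simpa [hik] using hb' i (by omega)

end P3

section P4

section primrec_aux
variable {α β : Type*} [Primcodable α] [Primcodable β]

lemma primrec_filter {f : α → List β} {p : α → β → Bool} (hf : Primrec f) (hp : Primrec₂ p) :
    Primrec fun a => (f a).filter (p a) := by
  have : Primrec fun a => (f a).filterMap
      (fun x => bif p a x then Option.some x else Option.none) :=
    Primrec.listFilterMap (f := f) (g := fun a x => bif p a x then Option.some x else Option.none) hf
      (Primrec.cond (hp.comp Primrec.fst Primrec.snd)
      (Primrec.option_some.comp Primrec.snd) (Primrec.const Option.none))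
  refine this.of_eq fun a => ?_
  induction f a with
  | nil => rfl
  | cons x l ih =>
    cases h : p a x
    · simp [h, ih]
    · simp [h, ih]

lemma primrec_any {f : α → List β} {p : α → β → Bool} (hf : Primrec f) (hp : Primrec₂ p) :
    Primrec fun a => (f a).any (p a) := by
  have : Primrec fun a => (f a).foldr (fun x r => p a x || r) false :=
    Primrec.list_foldr (f := f) (g := fun _ => false) (h := fun a x => p a x.1 || x.2) hf
      (Primrec.const false)
      (Primrec.or.comp (hp.comp Primrec.fst (Primrec.fst.comp Primrec.snd))
        (Primrec.snd.comp Primrec.snd))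
  refine this.of_eq fun a => ?_
  induction f a with
  | nil => rfl
  | cons x l ih => simp [ih]

lemma primrec_all {f : α → List β} {p : α → β → Bool} (hf : Primrec f) (hp : Primrec₂ p) :
    Primrec fun a => (f a).all (p a) := by
  have : Primrec fun a => (f a).foldr (fun x r => p a x && r) true :=
    Primrec.list_foldr (f := f) (g := fun _ => true) (h := fun a x => p a x.1 && x.2) hf
      (Primrec.const true)
      (Primrec.and.comp (hp.comp Primrec.fst (Primrec.fst.comp Primrec.snd))
        (Primrec.snd.comp Primrec.snd))
  refine this.of_eq fun a => ?_
  induction f a with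
  | nil => rfl
  | cons x l ih => simp [ih]
end primrec_aux

/-- frames: level, goal, a, base, counter, services -/
abbrev Frame := ℕ × ℕ × ℕ × ℕ × ℕ × List (ℕ × ℕ)
/-- configurations: stage, nice times, elements, stack -/
abbrev Conf := ℕ × List ℕ × List (ℕ × ℕ) × List Frame

/-- total mass of a list of elements as a dyadic `x / 2 ^ D` -/
def msum (E : List (ℕ × ℕ)) : ℕ × ℕ :=
  E.foldr (fun p q => (q.1 * 2 ^ p.2 + 2 ^ q.2, q.2 + p.2)) (0, 0)

noncomputable def mass (E : List (ℕ × ℕ)) : ℝ := (E.map fun p => hp p.2).sum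

lemma mass_nil : mass [] = 0 := by simp [mass]
lemma mass_cons (p E) : mass (p :: E) = hp p.2 + mass E := by simp [mass]
lemma mass_append (E F) : mass (E ++ F) = mass E + mass F := by simp [mass]
lemma mass_nonneg (E) : 0 ≤ mass E := by
  induction E with
  | nil => simp [mass]
  | cons p E ih => rw [mass_cons]; linarith [hp_nonneg p.2]

lemma msum_val (E) : ((msum E).1 : ℝ) * hp (msum E).2 = mass E := by
  induction E with
  | nil => simp [msum, mass]
  | cons p E ih =>
    rw [mass_cons, ← ih]
    have : msum (p :: E) = ((msum E).1 * 2 ^ p.2 + 2 ^ (msum E).2, (msum E).2 + p.2) := rfl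
    rw [this]
    simp only [hp_add]
    push_cast
    have h1 := hp_mul_pow p.2
    have h2 := hp_mul_pow (msum E).2
    linear_combination ((msum E).1 : ℝ) * hp (msum E).2 * h1 + hp p.2 * h2

lemma msum_primrec : Primrec msum := by
  refine Primrec.list_foldr (f := fun E : List (ℕ × ℕ) => E) (g := fun _ => ((0, 0) : ℕ × ℕ))
    (h := fun _ x => (x.2.1 * 2 ^ x.1.2 + 2 ^ x.2.2, x.2.2 + x.1.2)) Primrec.id (Primrec.const _) ?_
  have a1 : Primrec fun y : List (ℕ × ℕ) × (ℕ × ℕ) × (ℕ × ℕ) => y.2.2.1 :=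
    Primrec.fst.comp (Primrec.snd.comp Primrec.snd)
  have a2 : Primrec fun y : List (ℕ × ℕ) × (ℕ × ℕ) × (ℕ × ℕ) => y.2.2.2 :=
    Primrec.snd.comp (Primrec.snd.comp Primrec.snd)
  have a3 : Primrec fun y : List (ℕ × ℕ) × (ℕ × ℕ) × (ℕ × ℕ) => y.2.1.2 :=
    Primrec.snd.comp (Primrec.fst.comp Primrec.snd)
  exact Primrec.pair (Primrec.nat_add.comp (Primrec.nat_mul.comp a1 (pow2_primrec.comp a3))
    (pow2_primrec.comp a2)) (Primrec.nat_add.comp a2 a3)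

def le1 (E : List (ℕ × ℕ)) : Bool := decide ((msum E).1 ≤ 2 ^ (msum E).2)

lemma le1_iff (E) : le1 E = true ↔ mass E ≤ 1 := by
  unfold le1
  rw [decide_eq_true_iff, ← msum_val]
  have q := hp_mul_pow (msum E).2
  have p := hp_pos (msum E).2
  have : (msum E).1 ≤ 2 ^ (msum E).2 ↔ ((msum E).1 : ℝ) ≤ 2 ^ (msum E).2 := by
    exact_mod_cast Iff.rfl
  rw [this, ← q, mul_comm (hp _)]
  exact (mul_le_mul_iff_left₀ p).symm

def geg (E : List (ℕ × ℕ)) (g : ℕ) : Bool := decide (2 ^ (msum E).2 ≤ (msum E).1 * 2 ^ g)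

lemma geg_iff (E g) : geg E g = true ↔ hp g ≤ mass E := by
  unfold geg
  rw [decide_eq_true_iff, ← msum_val]
  have q := hp_mul_pow (msum E).2
  have p := hp_pos (msum E).2
  have q' := hp_mul_pow g
  have p' := hp_pos g
  have : 2 ^ (msum E).2 ≤ (msum E).1 * 2 ^ g ↔ (2 : ℝ) ^ (msum E).2 ≤ ((msum E).1 : ℝ) * 2 ^ g := by
    exact_mod_cast Iff.rfl
  rw [this, ← mul_le_mul_iff_left₀ (mul_pos p p')]
  have e1 : (2 : ℝ) ^ (msum E).2 * (hp (msum E).2 * hp g) = hp g := by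
    linear_combination hp g * q
  have e2 : ((msum E).1 : ℝ) * 2 ^ g * (hp (msum E).2 * hp g) = (msum E).1 * hp (msum E).2 := by
    linear_combination ((msum E).1 * hp (msum E).2) * q'
  rw [e1, e2]

lemma le1_primrec : Primrec le1 :=
  (Primrec.nat_le.comp (Primrec.fst.comp msum_primrec)
    (pow2_primrec.comp (Primrec.snd.comp msum_primrec))).decide

lemma geg_primrec : Primrec₂ geg :=
  (Primrec.nat_le.comp (pow2_primrec.comp (Primrec.snd.comp (msum_primrec.comp Primrec.fst)))
    (Primrec.nat_mul.comp (Primrec.fst.comp (msum_primrec.comp Primrec.fst))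
    (pow2_primrec.comp Primrec.snd))).decide

def eqS (σ τ : Str) : Bool := decide (σ = τ)
def eqO (σ τ : Option Str) : Bool := decide (σ = τ)
def eqN (m n : ℕ) : Bool := decide (m = n)
def leN (m n : ℕ) : Bool := decide (m ≤ n)
lemma eqS_iff (σ τ) : eqS σ τ = true ↔ σ = τ := by simp [eqS]
lemma eqO_iff (σ τ) : eqO σ τ = true ↔ σ = τ := by simp [eqO]
lemma eqN_iff (m n) : eqN m n = true ↔ m = n := by simp [eqN]
lemma leN_iff (m n) : leN m n = true ↔ m ≤ n := by simp [leN]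
lemma eqS_primrec : Primrec₂ eqS := Primrec.eq.decide
lemma eqO_primrec : Primrec₂ eqO := Primrec.eq.decide
lemma eqN_primrec : Primrec₂ eqN := Primrec.eq.decide
lemma leN_primrec : Primrec₂ leN := Primrec.nat_le.decide

section machine
variable (k : ℕ) (ev : ℕ → ℕ → Option Str) (len : ℕ → ℕ) (b : ℕ → ℕ → ℕ → Str)

/-- level of `n` with respect to nice times `H` -/
def lvl (H : List ℕ) (n : ℕ) : ℕ × ℕ :=
  H.foldr (fun s p => bif decide (n < s) && !decide (b p.1 p.2 n = b p.1 s n)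
    then (p.1 + 1, s) else p) (0, n)

def resp1 (C s i : ℕ) (p : ℕ × ℕ) (e : ℕ) : Bool :=
  leN (len e) (p.2 + C) && eqO (ev s e) (Option.some (b i s p.1))

def resp2 (C s : ℕ) (p : ℕ × ℕ) (i : ℕ) : Bool :=
  (List.range s).any (resp1 ev len b C s i p)

def resp3 (C s : ℕ) (p : ℕ × ℕ) : Bool := (List.range k).any (resp2 ev len b C s p)

def resp (C s : ℕ) (E : List (ℕ × ℕ)) : Bool := E.all (resp3 k ev len b C s)

def flt (H : List ℕ) (j : ℕ) (N : List (ℕ × ℕ)) : List (ℕ × ℕ) :=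
  N.filter fun p => decide (j ≤ (lvl b H p.1).1)

def goal (H : List ℕ) (E : List (ℕ × ℕ)) (fr : Frame) : Bool :=
  geg (flt b H fr.1 (E.take (E.length - fr.2.2.2.1))) fr.2.1

def rhit (j s e y : ℕ) (p : ℕ × ℕ) : Bool :=
  eqN p.1 e && eqS (b (j - 1) p.2 y) (b (j - 1) s y)

def rok (j s e : ℕ) (sv : List (ℕ × ℕ)) (σ : Str) : Bool :=
  leN σ.length s && !(sv.any (rhit b j s e σ.length))

def readyO (j s e : ℕ) (sv : List (ℕ × ℕ)) (o : Option Str) : Bool :=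
  o.casesOn (motive := fun _ => Bool) false (rok b j s e sv)

def ready (s : ℕ) (fr : Frame) : Bool :=
  readyO b fr.1 s fr.2.2.2.2.1.unpair.1 fr.2.2.2.2.2 (ev s fr.2.2.2.2.1.unpair.1)

def record (s : ℕ) (rest : List Frame) : List Frame :=
  rest.casesOn (motive := fun _ => List Frame) [] fun fr r =>
    (fr.1, fr.2.1, fr.2.2.1, fr.2.2.2.1, fr.2.2.2.2.1 + 1,
      (fr.2.2.2.2.1.unpair.1, s) :: fr.2.2.2.2.2) :: r

def bump (fr : Frame) : Frame :=
  (fr.1, fr.2.1, fr.2.2.1, fr.2.2.2.1, fr.2.2.2.2.1 + 1, fr.2.2.2.2.2)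

def child (E : List (ℕ × ℕ)) (fr : Frame) : Frame :=
  (fr.1 - 1, fr.2.2.1 + len fr.2.2.2.2.1.unpair.1, fr.2.2.1 + fr.2.2.2.2.1 + 3, E.length, 0, [])

def addE (s g : ℕ) (E : List (ℕ × ℕ)) : List (ℕ × ℕ) :=
  bif le1 ((s, g) :: E) then (s, g) :: E else E

def act1 (s : ℕ) (H : List ℕ) (E : List (ℕ × ℕ)) (fr : Frame) (rest : List Frame) : Conf :=
  bif ready ev b s fr then (s + 1, s :: H, E, child len E fr :: fr :: rest)
  else (s + 1, s :: H, E, bump fr :: rest)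

def act0 (s : ℕ) (H : List ℕ) (E : List (ℕ × ℕ)) (fr : Frame) (rest : List Frame) : Conf :=
  (s + 1, s :: H, addE s fr.2.1 E, fr :: rest)

def act2 (s : ℕ) (H : List ℕ) (E : List (ℕ × ℕ)) (rest : List Frame) : Conf :=
  (s + 1, s :: H, E, record s rest)

def act (s : ℕ) (H : List ℕ) (E : List (ℕ × ℕ)) (fr : Frame) (rest : List Frame) : Conf :=
  bif goal b (s :: H) E fr then act2 s H E rest
  else bif eqN fr.1 0 then act0 s H E fr rest
  else act1 ev len b s H E fr rest

def step (C : ℕ) (x : Conf) : Conf :=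
  bif resp k ev len b C x.1 x.2.2.1 then
    x.2.2.2.casesOn (motive := fun _ => Conf) (x.1 + 1, x.1 :: x.2.1, x.2.2.1, []) fun fr rest =>
      act ev len b x.1 x.2.1 x.2.2.1 fr rest
  else (x.1 + 1, x.2.1, x.2.2.1, x.2.2.2)

def JJ (C : ℕ) : ℕ := k * (2 ^ (C + 1) * (k + 1))

def iconf (C : ℕ) : Conf := (0, [], [], [(JJ k C, 1, 3, 0, 0, [])])

def conf (C q : ℕ) : Conf := (step k ev len b C)^[q] (iconf k C)

variable {k ev len b}

lemma lvl_primrec (hb : Primrec fun p : ℕ × ℕ × ℕ => b p.1 p.2.1 p.2.2)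
    : Primrec₂ (lvl b) := by
  refine Primrec.list_foldr (f := fun x : List ℕ × ℕ => x.1) (g := fun x => (0, x.2))
    (h := fun x y => bif decide (x.2 < y.1) && !decide (b y.2.1 y.2.2 x.2 = b y.2.1 y.1 x.2)
      then (y.2.1 + 1, y.1) else y.2) Primrec.fst (Primrec.pair (Primrec.const 0) Primrec.snd) ?_
  have a1 : Primrec fun z : (List ℕ × ℕ) × (ℕ × (ℕ × ℕ)) => z.1.2 := Primrec.snd.comp Primrec.fst
  have a2 : Primrec fun z : (List ℕ × ℕ) × (ℕ × (ℕ × ℕ)) => z.2.1 := Primrec.fst.comp Primrec.snd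
  have a3 : Primrec fun z : (List ℕ × ℕ) × (ℕ × (ℕ × ℕ)) => z.2.2 := Primrec.snd.comp Primrec.snd
  have a4 : Primrec fun z : (List ℕ × ℕ) × (ℕ × (ℕ × ℕ)) => z.2.2.1 := Primrec.fst.comp a3
  have a5 : Primrec fun z : (List ℕ × ℕ) × (ℕ × (ℕ × ℕ)) => z.2.2.2 := Primrec.snd.comp a3
  refine Primrec.cond (Primrec.and.comp (Primrec.nat_lt.comp a1 a2).decide (Primrec.not.comp
    (Primrec.eq.comp (hb.comp (Primrec.pair a4 (Primrec.pair a5 a1)))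
      (hb.comp (Primrec.pair a4 (Primrec.pair a2 a1)))).decide)) ?_ a3
  exact Primrec.pair (Primrec.succ.comp a4) a2

lemma goal_primrec (hb : Primrec fun p : ℕ × ℕ × ℕ => b p.1 p.2.1 p.2.2)
    :
    Primrec fun x : List ℕ × List (ℕ × ℕ) × Frame => goal b x.1 x.2.1 x.2.2 := by
  have a1 : Primrec fun x : List ℕ × List (ℕ × ℕ) × Frame => x.2.1 := Primrec.fst.comp Primrec.snd
  have a2 : Primrec fun x : List ℕ × List (ℕ × ℕ) × Frame => x.2.2 := Primrec.snd.comp Primrec.snd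
  have a3 : Primrec fun x : List ℕ × List (ℕ × ℕ) × Frame => x.2.2.2.1 :=
    Primrec.fst.comp (Primrec.snd.comp a2)
  have a4 : Primrec fun x : List ℕ × List (ℕ × ℕ) × Frame => x.2.2.2.2.2.1 :=
    Primrec.fst.comp (Primrec.snd.comp (Primrec.snd.comp (Primrec.snd.comp a2)))
  refine geg_primrec.comp ?_ a3
  refine primrec_filter (f := fun x : List ℕ × List (ℕ × ℕ) × Frame =>
      x.2.1.take (x.2.1.length - x.2.2.2.2.2.1))
    (p := fun x p => decide (x.2.2.1 ≤ (lvl b x.1 p.1).1)) ?_ ?_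
  · exact Primrec.list_take.comp (Primrec.nat_sub.comp (Primrec.list_length.comp a1) a4) a1
  · refine PrimrecPred.decide (p := fun z : (List ℕ × List (ℕ × ℕ) × Frame) × (ℕ × ℕ) =>
      z.1.2.2.1 ≤ (lvl b z.1.1 z.2.1).1) ?_
    exact Primrec.nat_le.comp ((Primrec.fst.comp a2).comp Primrec.fst)
      (Primrec.fst.comp ((lvl_primrec hb).comp (Primrec.fst.comp Primrec.fst)
        (Primrec.fst.comp Primrec.snd)))

lemma rhit_primrec (hb : Primrec fun p : ℕ × ℕ × ℕ => b p.1 p.2.1 p.2.2)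
    : Primrec₂ fun (x : ℕ × ℕ × ℕ × ℕ) (p : ℕ × ℕ) =>
    rhit b x.1 x.2.1 x.2.2.1 x.2.2.2 p := by
  have x1 : Primrec fun z : (ℕ × ℕ × ℕ × ℕ) × (ℕ × ℕ) => z.1.1 - 1 :=
    Primrec.nat_sub.comp (Primrec.fst.comp Primrec.fst) (Primrec.const 1)
  have x2 : Primrec fun z : (ℕ × ℕ × ℕ × ℕ) × (ℕ × ℕ) => z.1.2.1 :=
    Primrec.fst.comp (Primrec.snd.comp Primrec.fst)
  have x3 : Primrec fun z : (ℕ × ℕ × ℕ × ℕ) × (ℕ × ℕ) => z.1.2.2.1 :=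
    Primrec.fst.comp (Primrec.snd.comp (Primrec.snd.comp Primrec.fst))
  have x4 : Primrec fun z : (ℕ × ℕ × ℕ × ℕ) × (ℕ × ℕ) => z.1.2.2.2 :=
    Primrec.snd.comp (Primrec.snd.comp (Primrec.snd.comp Primrec.fst))
  have p1 : Primrec fun z : (ℕ × ℕ × ℕ × ℕ) × (ℕ × ℕ) => z.2.1 := Primrec.fst.comp Primrec.snd
  have p2 : Primrec fun z : (ℕ × ℕ × ℕ × ℕ) × (ℕ × ℕ) => z.2.2 := Primrec.snd.comp Primrec.snd
  have l1 : Primrec fun z : (ℕ × ℕ × ℕ × ℕ) × (ℕ × ℕ) => b (z.1.1 - 1) z.2.2 z.1.2.2.2 :=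
    hb.comp (Primrec.pair x1 (Primrec.pair p2 x4))
  have l2 : Primrec fun z : (ℕ × ℕ × ℕ × ℕ) × (ℕ × ℕ) => b (z.1.1 - 1) z.1.2.1 z.1.2.2.2 :=
    hb.comp (Primrec.pair x1 (Primrec.pair x2 x4))
  have m1 := eqS_primrec.comp l1 l2
  have m2 := eqN_primrec.comp p1 x3
  exact Primrec.and.comp m2 m1

lemma rok_primrec (hb : Primrec fun p : ℕ × ℕ × ℕ => b p.1 p.2.1 p.2.2)
    : Primrec₂ fun (x : ℕ × ℕ × ℕ × List (ℕ × ℕ)) (σ : Str) =>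
    rok b x.1 x.2.1 x.2.2.1 x.2.2.2 σ := by
  have x1 : Primrec fun z : (ℕ × ℕ × ℕ × List (ℕ × ℕ)) × Str => z.1.1 :=
    Primrec.fst.comp Primrec.fst
  have x2 : Primrec fun z : (ℕ × ℕ × ℕ × List (ℕ × ℕ)) × Str => z.1.2.1 :=
    Primrec.fst.comp (Primrec.snd.comp Primrec.fst)
  have x3 : Primrec fun z : (ℕ × ℕ × ℕ × List (ℕ × ℕ)) × Str => z.1.2.2.1 :=
    Primrec.fst.comp (Primrec.snd.comp (Primrec.snd.comp Primrec.fst))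
  have x4 : Primrec fun z : (ℕ × ℕ × ℕ × List (ℕ × ℕ)) × Str => z.1.2.2.2 :=
    Primrec.snd.comp (Primrec.snd.comp (Primrec.snd.comp Primrec.fst))
  have y : Primrec fun z : (ℕ × ℕ × ℕ × List (ℕ × ℕ)) × Str => z.2.length :=
    Primrec.list_length.comp Primrec.snd
  have w : Primrec fun z : (ℕ × ℕ × ℕ × List (ℕ × ℕ)) × Str =>
    (z.1.1, z.1.2.1, z.1.2.2.1, z.2.length) :=
    Primrec.pair x1 (Primrec.pair x2 (Primrec.pair x3 y))
  have h2 : Primrec₂ fun (z : (ℕ × ℕ × ℕ × List (ℕ × ℕ)) × Str) (p : ℕ × ℕ) =>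
      rhit b z.1.1 z.1.2.1 z.1.2.2.1 z.2.length p :=
    by
      have hX := (rhit_primrec hb).comp (w.comp Primrec.fst) Primrec.snd
      exact hX
  have h3 := Primrec.not.comp (primrec_any x4 h2)
  exact Primrec.and.comp (leN_primrec.comp y x2) h3

lemma readyO_primrec (hb : Primrec fun p : ℕ × ℕ × ℕ => b p.1 p.2.1 p.2.2)
    : Primrec₂ fun (x : ℕ × ℕ × ℕ × List (ℕ × ℕ)) (σ : Option Str) =>
    readyO b x.1 x.2.1 x.2.2.1 x.2.2.2 σ := by
  have h : Primrec₂ fun (z : (ℕ × ℕ × ℕ × List (ℕ × ℕ)) × Option Str) (σ : Str) =>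
    rok b z.1.1 z.1.2.1 z.1.2.2.1 z.1.2.2.2 σ :=
    by
      have hX := (rok_primrec hb).comp (Primrec.fst.comp (Primrec.fst (α := (ℕ × ℕ × ℕ × List (ℕ × ℕ)) × Option Str) (β := Str))) Primrec.snd
      exact hX
  have := Primrec.option_casesOn (o := fun z : (ℕ × ℕ × ℕ × List (ℕ × ℕ)) × Option Str => z.2)
    (f := fun _ => false) (g := fun z σ => rok b z.1.1 z.1.2.1 z.1.2.2.1 z.1.2.2.2 σ)
    Primrec.snd (Primrec.const _) h
  exact this


lemma ready_primrec (hev : Primrec₂ ev) (hb : Primrec fun p : ℕ × ℕ × ℕ => b p.1 p.2.1 p.2.2)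
    : Primrec₂ (ready ev b) := by
  have a0 : Primrec fun x : ℕ × Frame => x.2.2.2.2.2 :=
    Primrec.snd.comp (Primrec.snd.comp (Primrec.snd.comp (Primrec.snd.comp Primrec.snd)))
  have a1 : Primrec fun x : ℕ × Frame => x.2.2.2.2.2.1.unpair.1 :=
    Primrec.fst.comp (Primrec.unpair.comp (Primrec.fst.comp a0))
  have a2 : Primrec fun x : ℕ × Frame => x.2.1 := Primrec.fst.comp Primrec.snd
  have a3 : Primrec fun x : ℕ × Frame => (x.2.1, x.1, x.2.2.2.2.2.1.unpair.1, x.2.2.2.2.2.2) :=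
    Primrec.pair a2 (Primrec.pair Primrec.fst (Primrec.pair a1 (Primrec.snd.comp a0)))
  have a4 : Primrec fun x : ℕ × Frame => ev x.1 x.2.2.2.2.2.1.unpair.1 := hev.comp Primrec.fst a1
  have hX := (readyO_primrec hb).comp a3 a4
  exact hX


lemma resp1_primrec (hev : Primrec₂ ev) (hlen : Primrec len) (hb : Primrec fun p : ℕ × ℕ × ℕ => b p.1 p.2.1 p.2.2)
    : Primrec₂ fun (x : (ℕ × ℕ × ℕ) × (ℕ × ℕ)) (e : ℕ) =>
    resp1 ev len b x.1.1 x.1.2.1 x.1.2.2 x.2 e := by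
  have x1 : Primrec fun z : ((ℕ × ℕ × ℕ) × (ℕ × ℕ)) × ℕ => z.1.1.1 :=
    Primrec.fst.comp (Primrec.fst.comp Primrec.fst)
  have x2 : Primrec fun z : ((ℕ × ℕ × ℕ) × (ℕ × ℕ)) × ℕ => z.1.1.2.1 :=
    Primrec.fst.comp (Primrec.snd.comp (Primrec.fst.comp Primrec.fst))
  have x3 : Primrec fun z : ((ℕ × ℕ × ℕ) × (ℕ × ℕ)) × ℕ => z.1.1.2.2 :=
    Primrec.snd.comp (Primrec.snd.comp (Primrec.fst.comp Primrec.fst))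
  have x4 : Primrec fun z : ((ℕ × ℕ × ℕ) × (ℕ × ℕ)) × ℕ => z.1.2.1 :=
    Primrec.fst.comp (Primrec.snd.comp Primrec.fst)
  have x5 : Primrec fun z : ((ℕ × ℕ × ℕ) × (ℕ × ℕ)) × ℕ => z.1.2.2 :=
    Primrec.snd.comp (Primrec.snd.comp Primrec.fst)
  have l1 : Primrec fun z : ((ℕ × ℕ × ℕ) × (ℕ × ℕ)) × ℕ => b z.1.1.2.2 z.1.1.2.1 z.1.2.1 :=
    hb.comp (Primrec.pair x3 (Primrec.pair x2 x4))
  have l2 : Primrec fun z : ((ℕ × ℕ × ℕ) × (ℕ × ℕ)) × ℕ => ev z.1.1.2.1 z.2 :=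
    hev.comp x2 Primrec.snd
  have l3 : Primrec fun z : ((ℕ × ℕ × ℕ) × (ℕ × ℕ)) × ℕ => len z.2 := hlen.comp Primrec.snd
  exact Primrec.and.comp (leN_primrec.comp l3 (Primrec.nat_add.comp x5 x1))
    (eqO_primrec.comp l2 (Primrec.option_some.comp l1))

lemma resp2_primrec (hev : Primrec₂ ev) (hlen : Primrec len) (hb : Primrec fun p : ℕ × ℕ × ℕ => b p.1 p.2.1 p.2.2)
    : Primrec₂ fun (x : (ℕ × ℕ) × (ℕ × ℕ)) (i : ℕ) =>
    resp2 ev len b x.1.1 x.1.2 x.2 i := by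
  have y : Primrec fun z : ((ℕ × ℕ) × (ℕ × ℕ)) × ℕ => List.range z.1.1.2 :=
    Primrec.list_range.comp (Primrec.snd.comp (Primrec.fst.comp Primrec.fst))
  have w : Primrec fun z : ((ℕ × ℕ) × (ℕ × ℕ)) × ℕ => ((z.1.1.1, z.1.1.2, z.2), z.1.2) :=
    Primrec.pair (Primrec.pair (Primrec.fst.comp (Primrec.fst.comp Primrec.fst)) (Primrec.pair
      (Primrec.snd.comp (Primrec.fst.comp Primrec.fst)) Primrec.snd)) (Primrec.snd.comp Primrec.fst)
  have h : Primrec₂ fun (z : ((ℕ × ℕ) × (ℕ × ℕ)) × ℕ) (e : ℕ) =>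
      resp1 ev len b z.1.1.1 z.1.1.2 z.2 z.1.2 e :=
    by
      have hX := (resp1_primrec hev hlen hb).comp (w.comp Primrec.fst) Primrec.snd
      exact hX
  exact primrec_any y h

lemma resp3_primrec (hev : Primrec₂ ev) (hlen : Primrec len) (hb : Primrec fun p : ℕ × ℕ × ℕ => b p.1 p.2.1 p.2.2)
    : Primrec₂ fun (x : ℕ × ℕ) (p : ℕ × ℕ) =>
    resp3 k ev len b x.1 x.2 p := by
  have h : Primrec₂ fun (z : (ℕ × ℕ) × (ℕ × ℕ)) (i : ℕ) => resp2 ev len b z.1.1 z.1.2 z.2 i :=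
    resp2_primrec hev hlen hb
  exact primrec_any (Primrec.const (List.range k)) h

lemma resp_primrec (hev : Primrec₂ ev) (hlen : Primrec len) (hb : Primrec fun p : ℕ × ℕ × ℕ => b p.1 p.2.1 p.2.2)
    :
    Primrec fun x : ℕ × ℕ × List (ℕ × ℕ) => resp k ev len b x.1 x.2.1 x.2.2 := by
  have w : Primrec fun x : ℕ × ℕ × List (ℕ × ℕ) => (x.1, x.2.1) :=
    Primrec.pair Primrec.fst (Primrec.fst.comp Primrec.snd)
  have h : Primrec₂ fun (x : ℕ × ℕ × List (ℕ × ℕ)) (p : ℕ × ℕ) => resp3 k ev len b x.1 x.2.1 p :=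
    by
      have hX := (resp3_primrec (k := k) hev hlen hb).comp (w.comp Primrec.fst) Primrec.snd
      exact hX
  exact primrec_all (Primrec.snd.comp Primrec.snd) h

lemma record_primrec : Primrec₂ record := by
  refine Primrec.list_casesOn (f := fun x : ℕ × List Frame => x.2) (g := fun _ => [])
    (h := fun x y => (y.1.1, y.1.2.1, y.1.2.2.1, y.1.2.2.2.1, y.1.2.2.2.2.1 + 1,
      (y.1.2.2.2.2.1.unpair.1, x.1) :: y.1.2.2.2.2.2) :: y.2) Primrec.snd (Primrec.const _) ?_
  have a1 : Primrec fun z : (ℕ × List Frame) × (Frame × List Frame) => z.2.1 :=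
    Primrec.fst.comp Primrec.snd
  have a2 := Primrec.snd.comp a1
  have a3 := Primrec.snd.comp a2
  have a4 := Primrec.snd.comp a3
  have a5 := Primrec.snd.comp a4
  refine Primrec.list_cons.comp ?_ (Primrec.snd.comp Primrec.snd)
  refine Primrec.pair (Primrec.fst.comp a1) (Primrec.pair (Primrec.fst.comp a2)
    (Primrec.pair (Primrec.fst.comp a3) (Primrec.pair (Primrec.fst.comp a4)
    (Primrec.pair (Primrec.succ.comp (Primrec.fst.comp a5)) ?_))))
  exact Primrec.list_cons.comp (Primrec.pair (Primrec.fst.comp (Primrec.unpair.comp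
    (Primrec.fst.comp a5))) (Primrec.fst.comp Primrec.fst)) (Primrec.snd.comp a5)

lemma bump_primrec : Primrec bump := by
  have a1 : Primrec fun z : Frame => z := Primrec.id
  have a2 := Primrec.snd.comp a1
  have a3 := Primrec.snd.comp a2
  have a4 := Primrec.snd.comp a3
  have a5 := Primrec.snd.comp a4
  exact Primrec.pair (Primrec.fst.comp a1) (Primrec.pair (Primrec.fst.comp a2)
    (Primrec.pair (Primrec.fst.comp a3) (Primrec.pair (Primrec.fst.comp a4)
    (Primrec.pair (Primrec.succ.comp (Primrec.fst.comp a5)) (Primrec.snd.comp a5)))))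

lemma child_primrec (hlen : Primrec len)
    : Primrec₂ (child len) := by
  have a1 : Primrec fun z : List (ℕ × ℕ) × Frame => z.2 := Primrec.snd
  have a2 := Primrec.snd.comp a1
  have a3 := Primrec.snd.comp a2
  have a4 := Primrec.snd.comp a3
  have a5 := Primrec.snd.comp a4
  have b3 := Primrec.fst.comp a3
  have b5 := Primrec.fst.comp a5
  refine Primrec.pair (Primrec.nat_sub.comp (Primrec.fst.comp a1) (Primrec.const 1))
    (Primrec.pair (Primrec.nat_add.comp b3 (hlen.comp (Primrec.fst.comp (Primrec.unpair.comp b5))))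
    (Primrec.pair (Primrec.nat_add.comp (Primrec.nat_add.comp b3 b5) (Primrec.const 3))
    (Primrec.pair (Primrec.list_length.comp Primrec.fst) (Primrec.const _))))

lemma addE_primrec : Primrec fun x : ℕ × ℕ × List (ℕ × ℕ) => addE x.1 x.2.1 x.2.2 := by
  have a1 : Primrec fun x : ℕ × ℕ × List (ℕ × ℕ) => (x.1, x.2.1) :: x.2.2 :=
    Primrec.list_cons.comp (Primrec.pair Primrec.fst (Primrec.fst.comp Primrec.snd))
      (Primrec.snd.comp Primrec.snd)
  exact Primrec.cond (le1_primrec.comp a1) a1 (Primrec.snd.comp Primrec.snd)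

lemma act2_primrec : Primrec fun x : Conf × (Frame × List Frame) =>
    act2 x.1.1 x.1.2.1 x.1.2.2.1 x.2.2 := by
  have s1 : Primrec fun x : Conf × (Frame × List Frame) => x.1.1 := Primrec.fst.comp Primrec.fst
  have h1 : Primrec fun x : Conf × (Frame × List Frame) => x.1.2.1 :=
    Primrec.fst.comp (Primrec.snd.comp Primrec.fst)
  have e1 : Primrec fun x : Conf × (Frame × List Frame) => x.1.2.2.1 :=
    Primrec.fst.comp (Primrec.snd.comp (Primrec.snd.comp Primrec.fst))
  have f2 : Primrec fun x : Conf × (Frame × List Frame) => x.2.2 :=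
    Primrec.snd.comp Primrec.snd
  have r := record_primrec.comp s1 f2
  exact Primrec.pair (Primrec.succ.comp s1) (Primrec.pair (Primrec.list_cons.comp s1 h1)
    (Primrec.pair e1 r))

lemma act0_primrec : Primrec fun x : Conf × (Frame × List Frame) =>
    act0 x.1.1 x.1.2.1 x.1.2.2.1 x.2.1 x.2.2 := by
  have s1 : Primrec fun x : Conf × (Frame × List Frame) => x.1.1 := Primrec.fst.comp Primrec.fst
  have h1 : Primrec fun x : Conf × (Frame × List Frame) => x.1.2.1 :=
    Primrec.fst.comp (Primrec.snd.comp Primrec.fst)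
  have e1 : Primrec fun x : Conf × (Frame × List Frame) => x.1.2.2.1 :=
    Primrec.fst.comp (Primrec.snd.comp (Primrec.snd.comp Primrec.fst))
  have f1 : Primrec fun x : Conf × (Frame × List Frame) => x.2.1 :=
    Primrec.fst.comp Primrec.snd
  have f2 : Primrec fun x : Conf × (Frame × List Frame) => x.2.2 :=
    Primrec.snd.comp Primrec.snd
  have f3 : Primrec fun x : Conf × (Frame × List Frame) => x.2.1.2.1 :=
    Primrec.fst.comp (Primrec.snd.comp f1)
  have r : Primrec fun x : Conf × (Frame × List Frame) => addE x.1.1 x.2.1.2.1 x.1.2.2.1 :=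
    addE_primrec.comp (Primrec.pair s1 (Primrec.pair f3 e1))
  exact Primrec.pair (Primrec.succ.comp s1) (Primrec.pair (Primrec.list_cons.comp s1 h1)
    (Primrec.pair r (Primrec.list_cons.comp f1 f2)))

lemma act1_primrec (hev : Primrec₂ ev) (hlen : Primrec len) (hb : Primrec fun p : ℕ × ℕ × ℕ => b p.1 p.2.1 p.2.2)
    : Primrec fun x : Conf × (Frame × List Frame) =>
    act1 ev len b x.1.1 x.1.2.1 x.1.2.2.1 x.2.1 x.2.2 := by
  have s1 : Primrec fun x : Conf × (Frame × List Frame) => x.1.1 := Primrec.fst.comp Primrec.fst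
  have h1 : Primrec fun x : Conf × (Frame × List Frame) => x.1.2.1 :=
    Primrec.fst.comp (Primrec.snd.comp Primrec.fst)
  have e1 : Primrec fun x : Conf × (Frame × List Frame) => x.1.2.2.1 :=
    Primrec.fst.comp (Primrec.snd.comp (Primrec.snd.comp Primrec.fst))
  have f1 : Primrec fun x : Conf × (Frame × List Frame) => x.2.1 :=
    Primrec.fst.comp Primrec.snd
  have f2 : Primrec fun x : Conf × (Frame × List Frame) => x.2.2 :=
    Primrec.snd.comp Primrec.snd
  have ss := Primrec.succ.comp s1
  have hh := Primrec.list_cons.comp s1 h1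
  have r1 := (child_primrec hlen).comp e1 f1
  have r2 := bump_primrec.comp f1
  have r3 := (ready_primrec hev hb).comp s1 f1
  exact Primrec.cond r3 (Primrec.pair ss (Primrec.pair hh (Primrec.pair e1
    (Primrec.list_cons.comp r1 (Primrec.list_cons.comp f1 f2)))))
    (Primrec.pair ss (Primrec.pair hh (Primrec.pair e1 (Primrec.list_cons.comp r2 f2))))

lemma act_primrec (hev : Primrec₂ ev) (hlen : Primrec len) (hb : Primrec fun p : ℕ × ℕ × ℕ => b p.1 p.2.1 p.2.2)
    : Primrec fun x : Conf × (Frame × List Frame) =>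
    act ev len b x.1.1 x.1.2.1 x.1.2.2.1 x.2.1 x.2.2 := by
  have s1 : Primrec fun x : Conf × (Frame × List Frame) => x.1.1 := Primrec.fst.comp Primrec.fst
  have h1 : Primrec fun x : Conf × (Frame × List Frame) => x.1.2.1 :=
    Primrec.fst.comp (Primrec.snd.comp Primrec.fst)
  have e1 : Primrec fun x : Conf × (Frame × List Frame) => x.1.2.2.1 :=
    Primrec.fst.comp (Primrec.snd.comp (Primrec.snd.comp Primrec.fst))
  have f1 : Primrec fun x : Conf × (Frame × List Frame) => x.2.1 :=
    Primrec.fst.comp Primrec.snd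
  have f3 : Primrec fun x : Conf × (Frame × List Frame) => x.2.1.1 := Primrec.fst.comp f1
  have hh : Primrec fun x : Conf × (Frame × List Frame) => x.1.1 :: x.1.2.1 :=
    Primrec.list_cons.comp s1 h1
  have g : Primrec fun x : Conf × (Frame × List Frame) =>
      goal b (x.1.1 :: x.1.2.1) x.1.2.2.1 x.2.1 :=
    by
      have hX := (goal_primrec hb).comp (Primrec.pair hh (Primrec.pair e1 f1))
      exact hX
  have z : Primrec fun x : Conf × (Frame × List Frame) => eqN x.2.1.1 0 :=
    eqN_primrec.comp f3 (Primrec.const 0)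
  exact Primrec.cond g act2_primrec (Primrec.cond z act0_primrec (act1_primrec hev hlen hb))

lemma step_primrec (hev : Primrec₂ ev) (hlen : Primrec len) (hb : Primrec fun p : ℕ × ℕ × ℕ => b p.1 p.2.1 p.2.2)
    : Primrec₂ (step k ev len b) := by
  have s1 : Primrec fun x : ℕ × Conf => x.2.1 := Primrec.fst.comp Primrec.snd
  have h1 : Primrec fun x : ℕ × Conf => x.2.2.1 := Primrec.fst.comp (Primrec.snd.comp Primrec.snd)
  have e1 : Primrec fun x : ℕ × Conf => x.2.2.2.1 :=
    Primrec.fst.comp (Primrec.snd.comp (Primrec.snd.comp Primrec.snd))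
  have k1 : Primrec fun x : ℕ × Conf => x.2.2.2.2 :=
    Primrec.snd.comp (Primrec.snd.comp (Primrec.snd.comp Primrec.snd))
  have ss : Primrec fun x : ℕ × Conf => x.2.1 + 1 := Primrec.succ.comp s1
  have hh : Primrec fun x : ℕ × Conf => x.2.1 :: x.2.2.1 := Primrec.list_cons.comp s1 h1
  have r : Primrec fun x : ℕ × Conf => resp k ev len b x.1 x.2.1 x.2.2.2.1 :=
    by
      have hX := (resp_primrec (k := k) hev hlen hb).comp (Primrec.pair Primrec.fst (Primrec.pair s1 e1))
      exact hX
  have A : Primrec₂ fun (x : ℕ × Conf) (y : Frame × List Frame) =>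
      act ev len b x.2.1 x.2.2.1 x.2.2.2.1 y.1 y.2 :=
    by
      have hX := (act_primrec hev hlen hb).comp (Primrec.pair (Primrec.snd.comp (Primrec.fst (α := ℕ × Conf) (β := Frame × List Frame))) Primrec.snd)
      exact hX
  have c := Primrec.list_casesOn (f := fun x : ℕ × Conf => x.2.2.2.2)
    (g := fun x => ((x.2.1 + 1, x.2.1 :: x.2.2.1, x.2.2.2.1, []) : Conf))
    (h := fun x y => act ev len b x.2.1 x.2.2.1 x.2.2.2.1 y.1 y.2) k1
    (Primrec.pair ss (Primrec.pair hh (Primrec.pair e1 (Primrec.const _)))) A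
  exact Primrec.cond r c (Primrec.pair ss (Primrec.pair h1 (Primrec.pair e1 k1)))

lemma conf_primrec (hev : Primrec₂ ev) (hlen : Primrec len) (hb : Primrec fun p : ℕ × ℕ × ℕ => b p.1 p.2.1 p.2.2)
    : Primrec₂ (conf k ev len b) := by
  refine Primrec.nat_iterate (f := fun x : ℕ × ℕ => x.2) (g := fun x => iconf k x.1)
    (h := fun x y => step k ev len b x.1 y) Primrec.snd ?_ ?_
  · have : Primrec fun x : ℕ × ℕ => JJ k x.1 :=
      Primrec.nat_mul.comp (Primrec.const k) (Primrec.nat_mul.comp (pow2_primrec.comp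
        (Primrec.succ.comp Primrec.fst)) (Primrec.const (k + 1)))
    exact Primrec.pair (Primrec.const 0) (Primrec.pair (Primrec.const _) (Primrec.pair
      (Primrec.const _) (Primrec.list_cons.comp (Primrec.pair this (Primrec.const _))
      (Primrec.const _))))
  · exact (step_primrec hev hlen hb).comp (Primrec.fst.comp Primrec.fst) Primrec.snd

end machine

end P4

section P5

/-- the data of the step machine -/
structure Mach where
  k : ℕ
  ev : ℕ → ℕ → Option Str
  len : ℕ → ℕ
  b : ℕ → ℕ → ℕ → Str
  C : ℕ

namespace Mach
variable (D : Mach)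

def cf (q : ℕ) : Conf := conf D.k D.ev D.len D.b D.C q
def H (q : ℕ) : List ℕ := (D.cf q).2.1
def E (q : ℕ) : List (ℕ × ℕ) := (D.cf q).2.2.1
def St (q : ℕ) : List Frame := (D.cf q).2.2.2
def r (q : ℕ) : Prop := resp D.k D.ev D.len D.b D.C q (D.E q) = true
def L (q n : ℕ) : ℕ × ℕ := lvl D.b (D.H q) n
def F (q j : ℕ) (N : List (ℕ × ℕ)) : List (ℕ × ℕ) := flt D.b (D.H q) j N

lemma cf_succ (q) : D.cf (q + 1) = step D.k D.ev D.len D.b D.C (D.cf q) := by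
  simp only [cf, conf, Function.iterate_succ_apply']

lemma step_fst (k ev len b C) (x : Conf) : (step k ev len b C x).1 = x.1 + 1 := by
  obtain ⟨s, H, E, st⟩ := x
  unfold step
  cases h : resp k ev len b C s E
  · simp [h]
  · cases st with
    | nil => simp [h]
    | cons fr rest =>
      simp only [h, cond_true]
      unfold act
      cases goal b (s :: H) E fr
      · cases eqN fr.1 0
        · simp only [cond_false, act1]
          cases ready ev b s fr <;> rfl
        · rfl
      · rfl

lemma cf_fst (q) : (D.cf q).1 = q := by
  induction q with
  | zero => rfl
  | succ q ih => rw [cf_succ, step_fst, ih]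

lemma cf_eq (q) : D.cf q = (q, D.H q, D.E q, D.St q) := by
  conv_lhs => rw [← Prod.mk.eta (p := D.cf q), cf_fst]
  rfl

lemma not_r {q} (h : ¬ D.r q) :
    D.H (q + 1) = D.H q ∧ D.E (q + 1) = D.E q ∧ D.St (q + 1) = D.St q := by
  have h' : resp D.k D.ev D.len D.b D.C q (D.E q) = false := by simpa [r] using h
  have : D.cf (q + 1) = (q + 1, D.H q, D.E q, D.St q) := by
    rw [cf_succ, cf_eq]
    simp [step, h']
  simp [H, E, St, this]

lemma r_nil {q} (h : D.r q) (hs : D.St q = []) :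
    D.H (q + 1) = q :: D.H q ∧ D.E (q + 1) = D.E q ∧ D.St (q + 1) = [] := by
  have h' : resp D.k D.ev D.len D.b D.C q (D.E q) = true := h
  have : D.cf (q + 1) = (q + 1, q :: D.H q, D.E q, []) := by
    rw [cf_succ, cf_eq]
    simp [step, h', hs]
  simp [H, E, St, this]

lemma r_cons {q fr rest} (h : D.r q) (hs : D.St q = fr :: rest) :
    D.cf (q + 1) = act D.ev D.len D.b q (D.H q) (D.E q) fr rest := by
  have h' : resp D.k D.ev D.len D.b D.C q (D.E q) = true := h
  rw [cf_succ, cf_eq]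
  simp [step, h', hs]

lemma r_goal {q fr rest} (h : D.r q) (hs : D.St q = fr :: rest)
    (hg : goal D.b (q :: D.H q) (D.E q) fr = true) :
    D.cf (q + 1) = (q + 1, q :: D.H q, D.E q, record q rest) := by
  rw [r_cons D h hs]; simp [act, hg, act2]

lemma r_add {q fr rest} (h : D.r q) (hs : D.St q = fr :: rest)
    (hg : goal D.b (q :: D.H q) (D.E q) fr = false) (h0 : fr.1 = 0) :
    D.cf (q + 1) = (q + 1, q :: D.H q, addE q fr.2.1 (D.E q), fr :: rest) := by
  rw [r_cons D h hs]; simp [act, hg, h0, eqN, act0]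

lemma r_push {q fr rest} (h : D.r q) (hs : D.St q = fr :: rest)
    (hg : goal D.b (q :: D.H q) (D.E q) fr = false) (h0 : fr.1 ≠ 0)
    (hr : ready D.ev D.b q fr = true) :
    D.cf (q + 1) = (q + 1, q :: D.H q, D.E q, child D.len (D.E q) fr :: fr :: rest) := by
  rw [r_cons D h hs]; simp [act, hg, h0, eqN, act1, hr]

lemma r_bump {q fr rest} (h : D.r q) (hs : D.St q = fr :: rest)
    (hg : goal D.b (q :: D.H q) (D.E q) fr = false) (h0 : fr.1 ≠ 0)
    (hr : ready D.ev D.b q fr = false) :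
    D.cf (q + 1) = (q + 1, q :: D.H q, D.E q, bump fr :: rest) := by
  rw [r_cons D h hs]; simp [act, hg, h0, eqN, act1, hr]

lemma H_r {q} (h : D.r q) : D.H (q + 1) = q :: D.H q := by
  cases hs : D.St q with
  | nil => exact (r_nil D h hs).1
  | cons fr rest =>
    unfold H
    rw [r_cons D h hs]
    unfold act
    cases goal D.b (q :: D.H q) (D.E q) fr
    · cases eqN fr.1 0
      · simp only [cond_false, act1]
        cases ready D.ev D.b q fr <;> rfl
      · rfl
    · rfl

/-- how the set of elements evolves -/
lemma E_step (q) : D.E (q + 1) = D.E q ∨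
    ∃ g, D.E (q + 1) = (q, g) :: D.E q ∧ mass ((q, g) :: D.E q) ≤ 1 := by
  by_cases h : D.r q
  · cases hs : D.St q with
    | nil => exact Or.inl (r_nil D h hs).2.1
    | cons fr rest =>
      unfold E
      rw [r_cons D h hs]
      unfold act
      cases goal D.b (q :: D.H q) (D.E q) fr
      · cases eqN fr.1 0
        · simp only [cond_false, act1]
          cases ready D.ev D.b q fr <;> exact Or.inl rfl
        · simp only [cond_false, cond_true, act0, addE]
          cases hl : le1 ((q, fr.2.1) :: D.E q)
          · exact Or.inl rfl
          · exact Or.inr ⟨fr.2.1, rfl, (le1_iff _).1 hl⟩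
      · exact Or.inl rfl
  · exact Or.inl (D.not_r h).2.1

lemma E_zero : D.E 0 = [] := rfl
lemma H_zero : D.H 0 = [] := rfl
lemma St_zero : D.St 0 = [(JJ D.k D.C, 1, 3, 0, 0, [])] := rfl

lemma E_mass (q) : mass (D.E q) ≤ 1 := by
  induction q with
  | zero => simp [E_zero, mass]
  | succ q ih =>
    rcases D.E_step q with h | ⟨g, h, h'⟩
    · rw [h]; exact ih
    · rw [h]; exact h'

lemma E_mono {q q'} (h : q ≤ q') {p} (hp : p ∈ D.E q) : p ∈ D.E q' := by
  induction q', h using Nat.le_induction with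
  | base => exact hp
  | succ q' _ ih =>
    rcases D.E_step q' with h | ⟨g, h, h'⟩
    · rw [h]; exact ih
    · rw [h]; exact List.mem_cons_of_mem _ ih

lemma E_mem {q p} (h : p ∈ D.E q) : p.1 < q ∧ D.E (p.1 + 1) = p :: D.E p.1 := by
  induction q with
  | zero => simp [E_zero] at h
  | succ q ih =>
    rcases D.E_step q with h1 | ⟨g, h1, h'⟩
    · rw [h1] at h; exact ⟨by have := (ih h).1; omega, (ih h).2⟩
    · rw [h1, List.mem_cons] at h
      rcases h with rfl | h
      · exact ⟨by simp, h1⟩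
      · exact ⟨by have := (ih h).1; omega, (ih h).2⟩

lemma E_nodup (q) : (D.E q).Nodup := by
  induction q with
  | zero => simp [E_zero]
  | succ q ih =>
    rcases D.E_step q with h1 | ⟨g, h1, h'⟩
    · rw [h1]; exact ih
    · rw [h1, List.nodup_cons]
      exact ⟨fun h => by have := (D.E_mem h).1; simp at this, ih⟩

lemma E_inj {q p p'} (h : p ∈ D.E q) (h' : p' ∈ D.E q) (he : p.1 = p'.1) : p = p' := by
  have h1 := (D.E_mem h).2
  have h2 := (D.E_mem h').2
  rw [← he, h1] at h2
  exact (List.cons.inj h2).1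

/-! ### levels -/

lemma L_r {q n} (h : D.r q) : D.L (q + 1) n =
    if n < q ∧ D.b (D.L q n).1 (D.L q n).2 n ≠ D.b (D.L q n).1 q n
    then ((D.L q n).1 + 1, q) else D.L q n := by
  unfold L
  rw [D.H_r h]
  conv_lhs => unfold lvl
  rw [List.foldr_cons]
  change (bif _ then _ else _) = _
  rw [Bool.cond_eq_ite]
  congr 1
  simp [lvl]

lemma L_nr {q n} (h : ¬ D.r q) : D.L (q + 1) n = D.L q n := by
  unfold L; rw [(D.not_r h).1]

lemma L_step (q n) : D.L (q + 1) n = D.L q n ∨ (D.r q ∧ n < q ∧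
    D.b (D.L q n).1 (D.L q n).2 n ≠ D.b (D.L q n).1 q n ∧
    D.L (q + 1) n = ((D.L q n).1 + 1, q)) := by
  by_cases h : D.r q
  · rw [D.L_r h]
    split_ifs with h'
    · exact Or.inr ⟨h, h'.1, h'.2, rfl⟩
    · exact Or.inl rfl
  · exact Or.inl (D.L_nr h)

lemma L_zero (n) : D.L 0 n = (0, n) := rfl

lemma L_mono {q q'} (h : q ≤ q') (n) : (D.L q n).1 ≤ (D.L q' n).1 ∧
    ((D.L q n).1 = (D.L q' n).1 → D.L q n = D.L q' n) := by
  induction q', h using Nat.le_induction with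
  | base => simp
  | succ q' _ ih =>
    rcases D.L_step q' n with h | ⟨_, _, _, h⟩
    · rw [h]; exact ih
    · rw [h]
      refine ⟨by simp; omega, fun h => ?_⟩
      simp at h; omega

/-- Lemma A: after processing a nice time `t`, the current value agrees with the marker -/
lemma L_agree {t n} (h : D.r t) (hn : n < t) :
    D.b (D.L (t + 1) n).1 (D.L (t + 1) n).2 n = D.b (D.L (t + 1) n).1 t n := by
  rw [D.L_r h]
  split_ifs with h'
  · rfl
  · by_contra hc
    exact h' ⟨hn, hc⟩

/-- promotion -/
lemma promote {X : ℕ → ℕ → Bool} (hA : ∀ j, Approx (X j) (D.b j)) {j t s n y : ℕ} (ht : D.r t)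
    (hs : D.r s) (hts : t ≤ s) (hyn : y ≤ n) (hnt : n < t)
    (hl : j ≤ (D.L (t + 1) n).1) (hne : D.b j t y ≠ D.b j s y) : j + 1 ≤ (D.L (s + 1) n).1 := by
  by_contra hc
  obtain ⟨h1, h2⟩ := D.L_mono (show t + 1 ≤ s + 1 by omega) n
  have e1 : (D.L (t + 1) n).1 = j := by omega
  have e2 := h2 (by omega)
  have a1 := D.L_agree ht hnt
  have a2 := D.L_agree hs (show n < s by omega)
  rw [← e2, e1] at a2
  rw [e1] at a1
  exact hne ((hA j).coh hyn (a1.symm.trans a2))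

lemma mem_F {q j N p} : p ∈ D.F q j N ↔ p ∈ N ∧ j ≤ (D.L q p.1).1 := by
  simp [F, flt, L]

lemma F_append (q j N M) : D.F q j (N ++ M) = D.F q j N ++ D.F q j M := by
  simp [F, flt]

lemma F_zero (q N) : D.F q 0 N = N := by
  simp [F, flt]

end Mach

lemma mass_filter_le (N : List (ℕ × ℕ)) (f : ℕ × ℕ → Bool) : mass (N.filter f) ≤ mass N := by
  induction N with
  | nil => simp
  | cons p N ih =>
    rw [List.filter_cons, mass_cons]
    split_ifs
    · rw [mass_cons]; linarith
    · linarith [hp_nonneg p.2]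

lemma mass_filter_mono (N : List (ℕ × ℕ)) (f g : ℕ × ℕ → Bool)
    (h : ∀ p ∈ N, f p = true → g p = true) : mass (N.filter f) ≤ mass (N.filter g) := by
  induction N with
  | nil => simp
  | cons p N ih =>
    have ih' := ih fun p hp => h p (List.mem_cons_of_mem _ hp)
    rw [List.filter_cons, List.filter_cons]
    have := h p (List.mem_cons_self)
    split_ifs with h1 h2
    · rw [mass_cons, mass_cons]; linarith
    · exact absurd (this h1) h2
    · rw [mass_cons]; linarith [hp_nonneg p.2]
    · exact ih'

namespace Mach
variable (D : Mach)
lemma F_mass_le (q j N) : mass (D.F q j N) ≤ mass N := mass_filter_le _ _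

lemma F_mass_mono {q q' j j' N} (h : ∀ p ∈ N, j ≤ (D.L q p.1).1 → j' ≤ (D.L q' p.1).1) :
    mass (D.F q j N) ≤ mass (D.F q' j' N) := by
  apply mass_filter_mono
  intro p hp
  simpa [L] using h p hp
end Mach

end P5

section P6

/-- all the standing assumptions on the machine -/
structure Setup (U : Str →. Str) (X : ℕ → ℕ → Bool) (D : Mach) : Prop where
  opt : OptimalPF U
  pres : Pres U D.ev D.len
  hb : Primrec fun p : ℕ × ℕ × ℕ => D.b p.1 p.2.1 p.2.2
  app : ∀ j, Approx (X j) (D.b j)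
  ntriv : ∀ j, ¬ KTrivialSeq U (X j)
  rsp : ∀ q p, p ∈ D.E q → ∃ i < D.k, KC U (restrSeq (X i) p.1) ≤ ((p.2 + D.C : ℕ) : ℕ∞)

lemma resp_iff (k ev len b C s E) : resp k ev len b C s E = true ↔
    ∀ p ∈ E, ∃ i < k, ∃ e < s, len e ≤ p.2 + C ∧ ev s e = Option.some (b i s p.1) := by
  simp [resp, resp3, resp2, resp1, leN, eqO]

variable {U : Str →. Str} {X : ℕ → ℕ → Bool} {D : Mach}

lemma resp_eventually (S : Setup U X D) (q) :
    ∃ s₀, ∀ s, s₀ ≤ s → resp D.k D.ev D.len D.b D.C s (D.E q) = true := by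
  have key : ∀ p ∈ D.E q, ∃ s₀, ∀ s, s₀ ≤ s → ∃ i < D.k, ∃ e < s, D.len e ≤ p.2 + D.C ∧
      D.ev s e = Option.some (D.b i s p.1) := by
    intro p hp
    obtain ⟨i, hi, hk⟩ := S.rsp q p hp
    obtain ⟨s1, e, h1, h2⟩ := S.pres.kc _ _ hk
    obtain ⟨s2, h3⟩ := (S.app i).lim p.1
    refine ⟨s1 + s2 + e + 1, fun s hs => ⟨i, hi, e, by omega, h2, ?_⟩⟩
    rw [h3 s (by omega)]
    exact S.pres.mono (by omega) h1
  have : ∀ E : List (ℕ × ℕ), (∀ p ∈ E, p ∈ D.E q) →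
      ∃ s₀, ∀ s, s₀ ≤ s → resp D.k D.ev D.len D.b D.C s E = true := by
    intro E
    induction E with
    | nil => intro _; exact ⟨0, fun s _ => by simp [resp]⟩
    | cons p E ih =>
      intro hE
      obtain ⟨s1, h1⟩ := ih fun p hp => hE p (List.mem_cons_of_mem _ hp)
      obtain ⟨s2, h2⟩ := key p (hE p List.mem_cons_self)
      refine ⟨s1 + s2, fun s hs => ?_⟩
      rw [resp_iff]
      intro p' hp'
      rcases List.mem_cons.1 hp' with rfl | hp'
      · exact h2 s (by omega)
      · exact (resp_iff _ _ _ _ _ _ _).1 (h1 s (by omega)) p' hp'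
  exact this _ fun _ h => h

lemma wait (S : Setup U X D) (q) : ∃ s, q ≤ s ∧ D.r s ∧ D.E s = D.E q ∧ D.St s = D.St q ∧
    ∀ q', q ≤ q' → q' ≤ s → D.St q' = D.St q := by
  have hex : ∃ s, q ≤ s ∧ D.r s := by
    by_contra hc
    push Not at hc
    have hE : ∀ s, q ≤ s → D.E s = D.E q := by
      intro s hs
      induction s, hs using Nat.le_induction with
      | base => rfl
      | succ s hs ih => rw [(D.not_r (hc s hs)).2.1, ih]
    obtain ⟨s₀, h⟩ := resp_eventually S q
    refine hc (q + s₀) (by omega) ?_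
    unfold Mach.r
    rw [hE _ (by omega)]
    exact h _ (by omega)
  have h1 := Nat.find_spec hex
  have h2 : ∀ {s}, s < Nat.find hex → ¬ (q ≤ s ∧ D.r s) := fun h => Nat.find_min hex h
  have key : ∀ q', q ≤ q' → q' ≤ Nat.find hex → D.E q' = D.E q ∧ D.St q' = D.St q := by
    intro q' hq'
    induction q', hq' using Nat.le_induction with
    | base => simp
    | succ s hs ih =>
      intro hle
      have hn := D.not_r (fun hr => h2 (show s < Nat.find hex by omega) ⟨hs, hr⟩)
      rw [hn.2.1, hn.2.2]
      exact ih (by omega)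
  exact ⟨_, h1.1, h1.2, (key _ h1.1 le_rfl).1, (key _ h1.1 le_rfl).2, fun q' a b => (key q' a b).2⟩

/-- a frame is successfully popped -/
def Pop (D : Mach) (j g a q0 : ℕ) (rest : List Frame) : Prop :=
  ∃ t N, q0 ≤ t ∧ D.r t ∧ D.St (t + 1) = record t rest ∧ D.E (t + 1) = N ++ D.E q0 ∧
    hp g ≤ mass (D.F (t + 1) j N) ∧ mass N ≤ mass (D.F (t + 1) j N) + 2 * hp a ∧
    mass N ≤ hp g + 2 * hp a ∧ (∀ p ∈ N, q0 ≤ p.1 ∧ p.1 < t) ∧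
    ∀ q, q0 ≤ q → q ≤ t → rest.length < (D.St q).length

def Big (D : Mach) (j : ℕ) : Prop := ∀ q0 g a rest,
  D.St q0 = (j, g, a, (D.E q0).length, 0, []) :: rest → mass (D.E q0) + hp g + 2 * hp a ≤ 1 →
    Pop D j g a q0 rest

lemma goal_iff {s fr} {N : List (ℕ × ℕ)} {q0 : ℕ} (hr : D.r s) (hE : D.E s = N ++ D.E q0)
    (hb : fr.2.2.2.1 = (D.E q0).length) :
    goal D.b (s :: D.H s) (D.E s) fr = true ↔ hp fr.2.1 ≤ mass (D.F (s + 1) fr.1 N) := by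
  unfold goal Mach.F
  rw [geg_iff, D.H_r hr, hE, hb]
  simp

lemma cf_of {s H E St} {x : ℕ} (h : D.cf s = (x, H, E, St)) : D.H s = H ∧ D.E s = E ∧ D.St s = St := by
  simp [Mach.H, Mach.E, Mach.St, h]

lemma big_zero (S : Setup U X D) : Big D 0 := by
  intro q0 g a rest hst hB
  obtain ⟨s, hs, hr, hE, hS, hcon⟩ := wait S q0
  have pg := hp_pos g
  have pa := hp_pos a
  have hg : goal D.b (s :: D.H s) (D.E s) (0, g, a, (D.E q0).length, 0, []) = false := by
    rw [← Bool.not_eq_true, goal_iff (N := []) (q0 := q0) hr (by simpa using hE) rfl]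
    simp [Mach.F, flt, mass, pg]
  obtain ⟨_, h2, h3⟩ := cf_of (D.r_add hr (hS.trans hst) hg rfl)
  have hl : le1 ((s, g) :: D.E s) = true := by
    rw [le1_iff, mass_cons, hE]; simp only; linarith
  rw [hE] at hl
  simp only [addE, hl, cond_true, hE] at h2
  obtain ⟨t, ht, hrt, hEt, hSt, hcont⟩ := wait S (s + 1)
  have hN : D.E t = [(s, g)] ++ D.E q0 := by rw [hEt, h2]; rfl
  have hm : mass [(s, g)] = hp g := by simp [mass]
  have hg' : goal D.b (t :: D.H t) (D.E t) (0, g, a, (D.E q0).length, 0, []) = true := by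
    rw [goal_iff (N := [(s, g)]) (q0 := q0) hrt hN rfl, D.F_zero, hm]
  obtain ⟨_, h5, h6⟩ := cf_of (D.r_goal hrt (hSt.trans h3) hg')
  refine ⟨t, [(s, g)], by omega, hrt, h6, by rw [h5, hN], ?_, ?_, ?_, ?_, ?_⟩
  · rw [D.F_zero, hm]
  · rw [D.F_zero]; linarith
  · rw [hm]; linarith
  · simp; omega
  · intro q hq hqt
    rcases Nat.lt_or_ge s q with h | h
    · rw [hcont q (by omega) hqt, h3]; simp
    · rw [hcon q hq h, hst]; simp

/-- services -/
structure Svc where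
  e : ℕ
  t : ℕ
  m : ℕ
  y : ℕ
  seg : List (ℕ × ℕ)

structure SOK (D : Mach) (j a : ℕ) (w : Svc) : Prop where
  rt : D.r w.t
  out : ∃ σ, D.ev w.t w.e = Option.some σ ∧ σ.length = w.y
  els : ∀ p ∈ w.seg, w.y ≤ p.1 ∧ p.1 < w.t
  lo : hp (a + D.len w.e) ≤ mass (D.F (w.t + 1) j w.seg)
  waste : mass w.seg ≤ mass (D.F (w.t + 1) j w.seg) + 2 * hp (a + w.m + 3)
  hi : mass w.seg ≤ hp (a + D.len w.e) + 2 * hp (a + w.m + 3)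

def svs (W : List Svc) : List (ℕ × ℕ) := W.map fun w => (w.e, w.t)
def segs (W : List Svc) : List (ℕ × ℕ) := W.flatMap fun w => w.seg

lemma segs_cons (w W) : segs (w :: W) = w.seg ++ segs W := by simp [segs]
lemma segs_nil : segs [] = [] := by simp [segs]

/-- detection of a service (the program) -/
def Det (D : Mach) (q0 l i : ℕ) : Option ℕ :=
  bif leN q0 i && (leN (l + 2) (D.St i).length && eqN (D.St (i + 1)).length (l + 1)) then
    (((D.St (i + 1)).headI).2.2.2.2.2.head?).map Prod.fst else Option.none

noncomputable def dw (D : Mach) (o : Option ℕ) : ℝ := o.elim 0 fun e => hp (D.len e)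

structure Head (D : Mach) (j g a q0 : ℕ) (rest : List Frame) (q m : ℕ) (W : List Svc) : Prop where
  st : D.St q = (j + 1, g, a, (D.E q0).length, m, svs W) :: rest
  le : q0 + m ≤ q
  el : D.E q = segs W ++ D.E q0
  ok : ∀ w ∈ W, SOK D j a w ∧ w.t < q ∧ w.m < m
  mdis : W.Pairwise fun w w' => w.m ≠ w'.m
  dis : W.Pairwise fun w w' => w.e = w'.e → D.b j w.t w.y ≠ D.b j w'.t w.y
  hi : mass (segs W) ≤ hp g + 3 / 2 * hp a
  stk : ∀ q', q0 ≤ q' → q' ≤ q → rest.length < (D.St q').length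
  els : ∀ p ∈ segs W, q0 ≤ p.1
  tot : ∑ i ∈ Finset.range q, dw D (Det D q0 rest.length i) =
    (W.map fun w => hp (D.len w.e)).sum
  det : ∀ w ∈ W, Det D q0 rest.length w.t = Option.some w.e

lemma head_init {j g a q0 rest} (hst : D.St q0 = (j + 1, g, a, (D.E q0).length, 0, []) :: rest) :
    Head D j g a q0 rest q0 0 [] where
  st := hst
  le := by omega
  el := by simp [segs]
  ok := by simp
  mdis := List.Pairwise.nil
  dis := List.Pairwise.nil
  hi := by
    rw [segs_nil, mass_nil]; linarith [hp_pos g, hp_pos a]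
  stk := by
    intro q' h1 h2
    obtain rfl : q' = q0 := by omega
    rw [hst]; simp
  els := by simp [segs]
  tot := by
    simp only [List.map_nil, List.sum_nil]
    refine Finset.sum_eq_zero fun i hi => ?_
    have : ¬ q0 ≤ i := by simpa using hi
    simp [Det, leN, this, dw]
  det := by simp

lemma kraft_list (S : Setup U X D) (l : List ℕ) (hn : l.Nodup)
    (h : ∀ e ∈ l, ∃ s σ, D.ev s e = Option.some σ) : (l.map fun e => hp (D.len e)).sum ≤ 1 := by
  rw [← List.sum_toFinset _ hn]
  exact S.pres.kraft _ fun e he => h e (by simpa using he)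

lemma geo_sum (n : ℕ) : ∑ i ∈ Finset.range n, hp (i + 2) = 1 / 2 - hp (n + 1) := by
  induction n with
  | zero => simp [hp]
  | succ n ih => rw [Finset.sum_range_succ, ih, hp_succ (n + 1)]; ring

lemma m_list (l : List ℕ) (hn : l.Nodup) : (l.map fun m => hp (m + 2)).sum ≤ 1 / 2 := by
  rw [← List.sum_toFinset _ hn]
  have : l.toFinset ⊆ Finset.range (l.sum + 1) := by
    intro x hx
    have := List.single_le_sum (l := l) (by simp) x (by simpa using hx)
    simp; omega
  have := Finset.sum_le_sum_of_subset_of_nonneg (f := fun m => hp (m + 2)) this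
    fun i _ _ => hp_nonneg _
  rw [geo_sum] at this
  linarith [hp_pos (l.sum + 1 + 1)]

/-- validity of a service at time `s` -/
def vld (D : Mach) (j s : ℕ) (w : Svc) : Bool := eqS (D.b j w.t w.y) (D.b j s w.y)

lemma seg_bound (S : Setup U X D) {j a s : ℕ} (hs : D.r s) (W : List Svc)
    (ok : ∀ w ∈ W, SOK D j a w ∧ w.t ≤ s) :
    mass (segs W) ≤ mass (D.F (s + 1) (j + 1) (segs W)) +
      ((W.filter (vld D j s)).map fun w => hp (a + D.len w.e)).sum +
      (W.map fun w => 2 * hp (a + w.m + 3)).sum := by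
  induction W with
  | nil => simp [segs, mass, Mach.F, flt]
  | cons w W ih =>
    have ih' := ih fun w hw => ok w (List.mem_cons_of_mem _ hw)
    obtain ⟨o, ht⟩ := ok w List.mem_cons_self
    rw [segs_cons, D.F_append, mass_append, mass_append, List.filter_cons, List.map_cons,
      List.sum_cons]
    cases hv : vld D j s w
    · simp only [Bool.false_eq_true, if_false]
      have hv' : D.b j w.t w.y ≠ D.b j s w.y := fun h => by
        rw [← eqS_iff] at h
        rw [vld, h] at hv
        exact Bool.noConfusion hv
      have := D.F_mass_mono (q := w.t + 1) (q' := s + 1) (j := j) (j' := j + 1) (N := w.seg)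
        fun p hp hl => D.promote S.app o.rt hs ht (o.els p hp).1 (o.els p hp).2 hl hv'
      linarith [o.waste]
    · simp only [if_true, List.map_cons, List.sum_cons]
      have h0 := mass_nonneg (D.F (s + 1) (j + 1) w.seg)
      linarith [o.hi]

end P6

section P7

variable {U : Str →. Str} {X : ℕ → ℕ → Bool} {D : Mach}

lemma sum_map_mul (c : ℝ) {α : Type*} (l : List α) (f : α → ℝ) :
    (l.map fun x => c * f x).sum = c * (l.map f).sum := by
  induction l with
  | nil => simp
  | cons x l ih => simp [ih]; ring

lemma waste_sum (a : ℕ) (W : List Svc) : (W.map fun w => 2 * hp (a + w.m + 3)).sum =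
    hp a * ((W.map Svc.m).map fun m => hp (m + 2)).sum := by
  rw [List.map_map, ← sum_map_mul]
  congr 2
  funext w
  simp only [Function.comp]
  rw [add_assoc, hp_add a, show w.m + 3 = w.m + 2 + 1 by rfl, hp_succ]
  ring

lemma valid_sum (a : ℕ) (W : List Svc) : (W.map fun w => hp (a + D.len w.e)).sum =
    hp a * ((W.map Svc.e).map fun e => hp (D.len e)).sum := by
  rw [List.map_map, ← sum_map_mul]
  congr 2
  funext w
  simp only [Function.comp]
  rw [hp_add a]

lemma valid_nodup (S : Setup U X D) {j g a q0 rest q m W} (h : Head D j g a q0 rest q m W)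
    (s : ℕ) : ((W.filter (vld D j s)).map Svc.e).Nodup := by
  have h2 := h.dis.filter (vld D j s)
  unfold List.Nodup
  rw [List.pairwise_map]
  refine List.Pairwise.imp_of_mem ?_ h2
  intro w w' hw hw' hne he
  rw [List.mem_filter] at hw hw'
  obtain ⟨σ, h3, h4⟩ := (h.ok w hw.1).1.out
  obtain ⟨σ', h5, h6⟩ := (h.ok w' hw'.1).1.out
  have h3' := S.pres.mono (Nat.le_max_left w.t w'.t) h3
  have h5' := S.pres.mono (Nat.le_max_right w.t w'.t) h5
  rw [he, h5'] at h3'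
  have e1 : σ' = σ := Option.some.inj h3'
  have e2 : w'.y = w.y := by rw [← h4, ← h6, e1]
  have v1 := (eqS_iff _ _).1 hw.2
  have v2 := (eqS_iff _ _).1 hw'.2
  rw [e2] at v2
  exact hne he (v1.trans v2.symm)

/-- bound with room for one extra program `e` and one extra counter -/
lemma head_bound (S : Setup U X D) {j g a q0 rest q m W} (h : Head D j g a q0 rest q m W)
    {s : ℕ} (hs : D.r s) (hq : q ≤ s) :
    mass (segs W) ≤ mass (D.F (s + 1) (j + 1) (segs W)) + 3 / 2 * hp a ∧
    ∀ e σ, D.ev s e = Option.some σ → (∀ w ∈ W, w.e = e → D.b j w.t w.y ≠ D.b j s w.y) →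
      mass (segs W) + hp (a + D.len e) + 2 * hp (a + m + 3) ≤
        mass (D.F (s + 1) (j + 1) (segs W)) + 3 / 2 * hp a := by
  have hb := seg_bound S (a := a) hs W fun w hw => ⟨(h.ok w hw).1, by
    have := (h.ok w hw).2.1; omega⟩
  rw [waste_sum, valid_sum] at hb
  have pa := hp_pos a
  have nd := valid_nodup S h s
  have hev : ∀ e ∈ (W.filter (vld D j s)).map Svc.e, ∃ s σ, D.ev s e = Option.some σ := by
    intro e he
    obtain ⟨w, hw, rfl⟩ := List.mem_map.1 he
    obtain ⟨σ, h1, _⟩ := (h.ok w (List.mem_filter.1 hw).1).1.out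
    exact ⟨_, _, h1⟩
  have nm : (W.map Svc.m).Nodup := by
    unfold List.Nodup
    rw [List.pairwise_map]
    exact h.mdis
  constructor
  · have k1 := kraft_list S _ nd hev
    have k2 := m_list _ nm
    have := mul_le_mul_of_nonneg_left k1 pa.le
    have := mul_le_mul_of_nonneg_left k2 pa.le
    linarith
  · intro e σ hσ hnew
    have k1 := kraft_list S (e :: (W.filter (vld D j s)).map Svc.e) (by
      rw [List.nodup_cons]
      refine ⟨fun he => ?_, nd⟩
      obtain ⟨w, hw, hwe⟩ := List.mem_map.1 he
      rw [List.mem_filter] at hw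
      exact hnew w hw.1 hwe ((eqS_iff _ _).1 hw.2)) (by
      intro e' he'
      rcases List.mem_cons.1 he' with rfl | he'
      · exact ⟨_, _, hσ⟩
      · exact hev e' he')
    have k2 := m_list (m :: W.map Svc.m) (by
      rw [List.nodup_cons]
      refine ⟨fun he => ?_, nm⟩
      obtain ⟨w, hw, hwe⟩ := List.mem_map.1 he
      have := (h.ok w hw).2.2
      omega)
    rw [List.map_cons, List.sum_cons] at k1 k2
    have := mul_le_mul_of_nonneg_left k1 pa.le
    have := mul_le_mul_of_nonneg_left k2 pa.le
    rw [hp_add a, add_assoc a, hp_add a, show m + 3 = m + 2 + 1 by rfl, hp_succ (m + 2)]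
    linarith

lemma ready_iff (ev b) (s j g a base m : ℕ) (sv : List (ℕ × ℕ)) :
    ready ev b s (j + 1, g, a, base, m, sv) = true ↔ ∃ σ, ev s m.unpair.1 = Option.some σ ∧
      σ.length ≤ s ∧ ∀ p ∈ sv, p.1 = m.unpair.1 → b j p.2 σ.length ≠ b j s σ.length := by
  unfold ready readyO
  simp only
  cases h : ev s m.unpair.1 with
  | none => simp
  | some σ => simp [rok, rhit, leN, eqN, eqS]

lemma det_none_of_le {q0 l i} (h : (D.St i).length ≤ l + 1) : Det D q0 l i = Option.none := by
  have : ¬ (l + 2 ≤ (D.St i).length) := by omega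
  simp [Det, leN, this]

lemma det_none_of_gt {q0 l i} (h : l + 1 < (D.St (i + 1)).length) :
    Det D q0 l i = Option.none := by
  have : ¬ ((D.St (i + 1)).length = l + 1) := by omega
  simp [Det, eqN, this]

lemma sum_ext_zero (f : ℕ → ℝ) {q s : ℕ} (hqs : q ≤ s) (h : ∀ i, q ≤ i → i < s → f i = 0) :
    ∑ i ∈ Finset.range s, f i = ∑ i ∈ Finset.range q, f i := by
  induction s, hqs using Nat.le_induction with
  | base => rfl
  | succ s hs ih =>
    rw [Finset.sum_range_succ, ih fun i a b => h i a (by omega), h s hs (by omega), add_zero]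

/-- the result of one round at the head of the frame -/
lemma head_step (S : Setup U X D) {j g a q0 rest q m W} (hbig : Big D j)
    (hB : mass (D.E q0) + hp g + 2 * hp a ≤ 1) (h : Head D j g a q0 rest q m W) :
    Pop D (j + 1) g a q0 rest ∨ ∃ q' W', Head D j g a q0 rest q' (m + 1) W' ∧
      ∃ s, q ≤ s ∧ ∀ σ, D.ev s m.unpair.1 = Option.some σ → σ.length ≤ s →
        ∃ w ∈ W', w.e = m.unpair.1 ∧
          (D.b j w.t σ.length = D.b j s σ.length ∨ s ≤ w.t) := by
  obtain ⟨s, hs, hr, hE, hS, hcon⟩ := wait S q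
  have pa := hp_pos a
  have hq := h.le
  obtain ⟨hb1, hb2⟩ := head_bound S h hr hs
  have hE' : D.E s = segs W ++ D.E q0 := hE.trans h.el
  have hS' := hS.trans h.st
  have hlq : (D.St q).length = rest.length + 1 := by rw [h.st]; simp
  have hstk : ∀ q', q0 ≤ q' → q' ≤ s → rest.length < (D.St q').length := by
    intro q' h1 h2
    rcases Nat.lt_or_ge q q' with h3 | h3
    · rw [hcon q' h3.le h2, hlq]; omega
    · exact h.stk q' h1 h3
  have hd0 : ∀ i, q ≤ i → i ≤ s → Det D q0 rest.length i = Option.none := by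
    intro i h1 h2
    exact det_none_of_le (by rw [hcon i h1 h2, hlq])
  have gi := goal_iff (fr := (j + 1, g, a, (D.E q0).length, m, svs W)) hr hE' rfl
  cases hg : goal D.b (s :: D.H s) (D.E s) (j + 1, g, a, (D.E q0).length, m, svs W)
  · have hlt : mass (D.F (s + 1) (j + 1) (segs W)) < hp g := by
      by_contra hc
      rw [gi.2 (not_lt.1 hc)] at hg
      exact Bool.noConfusion hg
    right
    have ri := ready_iff D.ev D.b s j g a (D.E q0).length m (svs W)
    cases hrd : ready D.ev D.b s (j + 1, g, a, (D.E q0).length, m, svs W)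
    · obtain ⟨_, e2, e3⟩ := cf_of (D.r_bump hr hS' hg (Nat.succ_ne_zero j) hrd)
      refine ⟨s + 1, W, ⟨e3, by omega, by rw [e2, hE'], ?_, h.mdis, h.dis, h.hi, ?_, h.els, ?_,
        h.det⟩, s, hs, ?_⟩
      · intro w hw
        obtain ⟨o1, o2, o3⟩ := h.ok w hw
        exact ⟨o1, by omega, by omega⟩
      · intro q' h1 h2
        rcases Nat.lt_or_ge s q' with h3 | h3
        · obtain rfl : q' = s + 1 := by omega
          rw [e3]; simp
        · exact hstk q' h1 h3
      · rw [← h.tot]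
        refine sum_ext_zero _ (by omega) fun i h1 h2 => ?_
        rw [hd0 i h1 (by omega)]; rfl
      · intro σ h1 h2
        by_contra hc
        push Not at hc
        have : ready D.ev D.b s (j + 1, g, a, (D.E q0).length, m, svs W) = true := by
          refine ri.2 ⟨σ, h1, h2, ?_⟩
          intro p hp hpe
          obtain ⟨w, hw, rfl⟩ := List.mem_map.1 hp
          exact (hc w hw hpe).1
        rw [this] at hrd
        exact Bool.noConfusion hrd
    · obtain ⟨σ, hσ, hσs, hnew⟩ := ri.1 hrd
      obtain ⟨_, e2, e3⟩ := cf_of (D.r_push hr hS' hg (Nat.succ_ne_zero j) hrd)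
      have hy : ∀ w ∈ W, w.e = m.unpair.1 → w.y = σ.length := by
        intro w hw he
        obtain ⟨τ, t1, t2⟩ := (h.ok w hw).1.out
        have := S.pres.mono (show w.t ≤ s by have := (h.ok w hw).2.1; omega) t1
        rw [he, hσ] at this
        rw [← t2, Option.some.inj this]
      have hnew' : ∀ w ∈ W, w.e = m.unpair.1 → D.b j w.t σ.length ≠ D.b j s σ.length := by
        intro w hw he
        exact hnew (w.e, w.t) (List.mem_map.2 ⟨w, hw, rfl⟩) he
      have hbud := hb2 m.unpair.1 σ hσ (by
        intro w hw he
        rw [hy w hw he]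
        exact hnew' w hw he)
      have hst1 : D.St (s + 1) = (j, a + D.len m.unpair.1, a + m + 3, (D.E (s + 1)).length, 0, []) ::
          (j + 1, g, a, (D.E q0).length, m, svs W) :: rest := by
        rw [e3, e2]; rfl
      have hm1 : mass (D.E (s + 1)) = mass (segs W) + mass (D.E q0) := by
        rw [e2, hE', mass_append]
      obtain ⟨t, N, t1, t2, t3, t4, t5, t6, t7, t8, t9⟩ := hbig (s + 1) _ _ _ hst1 (by linarith)
      have hdt : Det D q0 rest.length t = Option.some m.unpair.1 := by
        have a1 := t9 t t1 le_rfl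
        have a2 : rest.length + 2 ≤ (D.St t).length := by simp at a1; omega
        have a3 : q0 ≤ t := by omega
        simp [Det, leN, eqN, a2, a3, t3, record]
      refine ⟨t + 1, ⟨m.unpair.1, t, m, σ.length, N⟩ :: W, ⟨?_, ?_, ?_, ?_, ?_, ?_, ?_, ?_, ?_, ?_,
        ?_⟩, s, hs, ?_⟩
      · rw [t3]; rfl
      · omega
      · rw [t4, e2, hE', segs_cons]; simp
      · intro w hw
        rcases List.mem_cons.1 hw with rfl | hw
        · refine ⟨⟨t2, ⟨σ, S.pres.mono (by simp only; omega) hσ, rfl⟩, ?_, t5, t6, t7⟩,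
            by simp, by simp⟩
          intro p hp
          have := t8 p hp
          simp only
          omega
        · obtain ⟨o1, o2, o3⟩ := h.ok w hw
          exact ⟨o1, by omega, by omega⟩
      · refine List.pairwise_cons.2 ⟨?_, h.mdis⟩
        intro w hw
        have := (h.ok w hw).2.2
        simp only
        omega
      · refine List.pairwise_cons.2 ⟨?_, h.dis⟩
        intro w hw he heq
        simp only at he heq
        have hwt := (h.ok w hw).2.1
        exact hnew' w hw he.symm ((S.app j).sand (show w.t ≤ s by omega)
          (show s ≤ t by omega) heq.symm).symm
      · rw [segs_cons, mass_append]
        simp only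
        linarith
      · intro q' h1 h2
        rcases Nat.lt_or_ge s q' with h3 | h3
        · rcases Nat.lt_or_ge t q' with h4 | h4
          · obtain rfl : q' = t + 1 := by omega
            rw [t3]; simp [record]
          · have := t9 q' h3 h4
            simp at this; omega
        · exact hstk q' h1 h3
      · intro p hp
        rw [segs_cons, List.mem_append] at hp
        rcases hp with hp | hp
        · have := (t8 p hp).1; omega
        · exact h.els p hp
      · rw [Finset.sum_range_succ, hdt, sum_ext_zero (q := q) _ (by omega), h.tot, List.map_cons,
          List.sum_cons, add_comm]
        · rfl
        · intro i h1 h2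
          rcases Nat.lt_or_ge s i with h3 | h3
          · have := t9 (i + 1) (by omega) (by omega)
            rw [det_none_of_gt (by simpa using this)]; rfl
          · rw [hd0 i h1 h3]; rfl
      · intro w hw
        rcases List.mem_cons.1 hw with rfl | hw
        · exact hdt
        · exact h.det w hw
      · intro τ h1 h2
        exact ⟨_, List.mem_cons_self, rfl, Or.inr (by simp only; omega)⟩
  · left
    obtain ⟨_, e2, e3⟩ := cf_of (D.r_goal hr hS' hg)
    refine ⟨s, segs W, by omega, hr, e3, by rw [e2, hE'], gi.1 hg, by linarith, by
      linarith [h.hi], ?_, hstk⟩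
    intro p hp
    refine ⟨h.els p hp, ?_⟩
    obtain ⟨w, hw, hpw⟩ := List.mem_flatMap.1 hp
    have := ((h.ok w hw).1.els p hpw).2
    have := (h.ok w hw).2.1
    omega

end P7

section P8

variable {U : Str →. Str} {X : ℕ → ℕ → Bool} {D : Mach}

lemma St_primrec (S : Setup U X D) : Primrec D.St := by
  have h := (conf_primrec (k := D.k) S.pres.pev S.pres.plen S.hb).comp (Primrec.const D.C)
    (Primrec.id (α := ℕ))
  exact Primrec.snd.comp (Primrec.snd.comp (Primrec.snd.comp h))

lemma det_primrec (S : Setup U X D) (q0 l : ℕ) : Primrec (Det D q0 l) := by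
  have h1 := St_primrec S
  have h2 : Primrec fun i : ℕ => D.St (i + 1) := h1.comp Primrec.succ
  have c1 := leN_primrec.comp (Primrec.const (α := ℕ) q0) Primrec.id
  have c2 := leN_primrec.comp (Primrec.const (α := ℕ) (l + 2)) (Primrec.list_length.comp h1)
  have c3 := eqN_primrec.comp (Primrec.list_length.comp h2) (Primrec.const (α := ℕ) (l + 1))
  have c := Primrec.and.comp c1 (Primrec.and.comp c2 c3)
  have d1 := Primrec.list_headI.comp h2
  have d2 := Primrec.snd.comp (Primrec.snd.comp (Primrec.snd.comp (Primrec.snd.comp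
    (Primrec.snd.comp d1))))
  have d3 := Primrec.list_head?.comp d2
  have d0 : Primrec₂ fun (_ : ℕ) (x : ℕ × ℕ) => x.1 := Primrec.fst.comp Primrec.snd
  have d4 := Primrec.option_map d3 d0
  exact Primrec.cond c d4 (Primrec.const _)

/-- the requests certifying triviality -/
def reqR (D : Mach) (j a q0 l i : ℕ) : Option (ℕ × Str) :=
  (Det D q0 l i).bind fun e => (D.ev i e).map fun σ => (D.len e + a + 2, D.b j i σ.length)

lemma reqR_primrec (S : Setup U X D) (j a q0 l : ℕ) : Primrec (reqR D j a q0 l) := by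
  have i1 : Primrec fun z : (ℕ × ℕ) × Str => z.1.1 := Primrec.fst.comp Primrec.fst
  have e1 : Primrec fun z : (ℕ × ℕ) × Str => z.1.2 := Primrec.snd.comp Primrec.fst
  have s1 : Primrec fun z : (ℕ × ℕ) × Str => z.2.length := Primrec.list_length.comp Primrec.snd
  have r1 := S.pres.plen.comp e1
  have r2 := Primrec.nat_add.comp r1 (Primrec.const (α := (ℕ × ℕ) × Str) a)
  have r3 := Primrec.nat_add.comp r2 (Primrec.const (α := (ℕ × ℕ) × Str) 2)
  have b1 := S.hb.comp (Primrec.pair (Primrec.const (α := (ℕ × ℕ) × Str) j) (Primrec.pair i1 s1))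
  have m1 := Primrec.pair r3 b1
  have ev1 := S.pres.pev.comp (Primrec.fst (α := ℕ) (β := ℕ)) Primrec.snd
  have m2 := Primrec.option_map (g := fun (z : ℕ × ℕ) (σ : Str) =>
    (D.len z.2 + a + 2, D.b j z.1 σ.length)) ev1 m1
  have m3 : Primrec₂ fun (i e : ℕ) => (D.ev i e).map fun σ : Str =>
    (D.len e + a + 2, D.b j i σ.length) := m2
  exact Primrec.option_bind (det_primrec S q0 l) m3

lemma wt_req (j a q0 l i) : wt (reqR D j a q0 l i) ≤ hp (a + 2) * dw D (Det D q0 l i) := by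
  unfold reqR
  cases Det D q0 l i with
  | none => simp [wt, dw]
  | some e =>
    simp only [Option.bind_some, dw, Option.elim_some]
    cases D.ev i e with
    | none =>
      simp only [Option.map_none, wt]
      exact mul_nonneg (hp_nonneg _) (hp_nonneg _)
    | some σ =>
      simp only [Option.map_some, wt]
      rw [add_assoc, hp_add, mul_comm]

lemma wt_nonneg (o) : 0 ≤ wt o := by
  cases o with
  | none => simp [wt]
  | some p => exact hp_nonneg _

lemma lo_sum {j a} (W : List Svc) (ok : ∀ w ∈ W, SOK D j a w) :
    hp a * (W.map fun w => hp (D.len w.e)).sum ≤ mass (segs W) := by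
  induction W with
  | nil => simp [segs, mass]
  | cons w W ih =>
    have ih' := ih fun w hw => ok w (List.mem_cons_of_mem _ hw)
    have o := ok w List.mem_cons_self
    rw [segs_cons, mass_append, List.map_cons, List.sum_cons, mul_add, ← hp_add]
    have := D.F_mass_le (q := w.t + 1) (j := j) (N := w.seg)
    linarith [o.lo]

theorem big_succ (S : Setup U X D) {j} (hbig : Big D j) : Big D (j + 1) := by
  intro q0 g a rest hst hB
  by_contra hnp
  have heads : ∀ m, ∃ q W, Head D j g a q0 rest q m W := by
    intro m
    induction m with
    | zero => exact ⟨q0, [], head_init hst⟩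
    | succ m ih =>
      obtain ⟨q, W, h⟩ := ih
      rcases head_step S hbig hB h with h | ⟨q', W', h, _⟩
      · exact absurd h hnp
      · exact ⟨q', W', h⟩
  obtain ⟨c, hc⟩ := kc_lemma S.opt (reqR D j a q0 rest.length)
    (reqR_primrec S j a q0 rest.length).to_comp (by
      intro N
      obtain ⟨q, W, h⟩ := heads N
      have hq := h.le
      have h1 : ∑ i ∈ Finset.range N, wt (reqR D j a q0 rest.length i) ≤
          ∑ i ∈ Finset.range q, wt (reqR D j a q0 rest.length i) :=
        Finset.sum_le_sum_of_subset_of_nonneg (by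
          intro x hx; simp only [Finset.mem_range] at hx ⊢; omega) fun _ _ _ => wt_nonneg _
      have h2 := Finset.sum_le_sum fun i (_ : i ∈ Finset.range q) =>
        wt_req (D := D) j a q0 rest.length i
      rw [← Finset.mul_sum, h.tot] at h2
      have h3 := lo_sum (j := j) (a := a) W fun w hw => (h.ok w hw).1
      have h4 := h.hi
      have h5 := hp_le_one g
      have h6 := hp_le_one a
      have h7 : hp (a + 2) = hp a / 4 := by rw [hp_succ, hp_succ]; ring
      rw [h7] at h2
      linarith)
  refine S.ntriv j ⟨a + 2 + c, fun y => ?_⟩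
  by_cases hT : KC U (zeroStr y) = ⊤
  · rw [hT]; simp
  obtain ⟨Lv, hLv⟩ := ENat.ne_top_iff_exists.1 hT
  obtain ⟨s0, e, he, hle⟩ := S.pres.kc _ Lv hLv.symm.le
  obtain ⟨s1, hs1⟩ := (S.app j).lim y
  obtain ⟨q, W, h⟩ := heads (Nat.pair e (s0 + s1 + y))
  have hm := Nat.right_le_pair e (s0 + s1 + y)
  have hq := h.le
  rcases head_step S hbig hB h with h | ⟨q', W', h', s, hs, hdec⟩
  · exact absurd h hnp
  rw [Nat.unpair_pair] at hdec
  obtain ⟨w, hw, hwe, hwb⟩ := hdec (zeroStr y) (S.pres.mono (by omega) he)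
    (by simp [zeroStr]; omega)
  have hlen : (zeroStr y).length = y := by simp [zeroStr]
  rw [hlen] at hwb
  have hb : D.b j w.t y = restrSeq (X j) y := by
    rcases hwb with h | h
    · rw [h]; exact hs1 _ (by omega)
    · exact hs1 _ (by omega)
  obtain ⟨σ, hσ, hσy⟩ := (h'.ok w hw).1.out
  have hσz : σ.length = y := by
    rw [hwe] at hσ
    have e1 := S.pres.mono (le_max_left w.t s0) hσ
    have e2 := S.pres.mono (le_max_right w.t s0) he
    rw [e1] at e2
    rw [Option.some.inj e2, hlen]
  have hR : reqR D j a q0 rest.length w.t = Option.some (D.len e + a + 2, restrSeq (X j) y) := by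
    unfold reqR
    rw [h'.det w hw, Option.bind_some, hσ, Option.map_some, hσz, hb, hwe]
  have := hc _ _ _ hR
  refine this.trans ?_
  rw [← hLv]
  norm_cast
  omega

theorem big_all (S : Setup U X D) (j) : Big D j := by
  induction j with
  | zero => exact big_zero S
  | succ j ih => exact big_succ S ih

end P8

section P9

variable {U : Str →. Str} {X : ℕ → ℕ → Bool} {D : Mach}

lemma level_path (D : Mach) (q n : ℕ) : ∃ T : ℕ → ℕ, T 0 = n ∧ T (D.L q n).1 = (D.L q n).2 ∧
    ∀ p < (D.L q n).1, T p < T (p + 1) ∧ D.r (T (p + 1)) ∧ n < T (p + 1) ∧ T (p + 1) < q ∧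
      D.b p (T p) n ≠ D.b p (T (p + 1)) n := by
  induction q with
  | zero => exact ⟨fun _ => n, rfl, rfl, fun p hp => absurd hp (by rw [D.L_zero]; simp)⟩
  | succ q ih =>
    obtain ⟨T, h0, h1, h2⟩ := ih
    rcases D.L_step q n with h | ⟨hr, hn, hne, h⟩
    · rw [h]
      exact ⟨T, h0, h1, fun p hp => by
        obtain ⟨a1, a2, a3, a4, a5⟩ := h2 p hp
        exact ⟨a1, a2, a3, by omega, a5⟩⟩
    · rw [h]
      generalize hl : (D.L q n).1 = l at *
      refine ⟨Function.update T (l + 1) q, ?_, ?_, ?_⟩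
      · rw [Function.update_of_ne (by omega), h0]
      · simp
      · intro p hp
        simp only at hp
        rw [Function.update_of_ne (show p ≠ l + 1 by omega)]
        by_cases hpl : p = l
        · subst hpl
          rw [Function.update_self]
          refine ⟨?_, hr, hn, by omega, by rw [h1]; exact hne⟩
          rcases Nat.eq_zero_or_pos p with rfl | hpos
          · rw [h0]; exact hn
          · have := (h2 (p - 1) (by omega)).2.2.2.1
            rwa [Nat.sub_add_cancel hpos] at this
        · rw [Function.update_of_ne (by omega)]
          obtain ⟨a1, a2, a3, a4, a5⟩ := h2 p (by omega)
          exact ⟨a1, a2, a3, by omega, a5⟩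

lemma certs (S : Setup U X D) (hk : 0 < D.k) (hper : ∀ j, D.b (j % D.k) = D.b j) {q M : ℕ}
    {p : ℕ × ℕ} (hp : p ∈ D.E q) (hl : D.k * M ≤ (D.L q p.1).1) :
    ∃ φ : ℕ → ℕ × ℕ, (∀ m < M, (φ m).1 < D.k ∧ D.len (φ m).2 ≤ p.2 + D.C ∧
      ∃ s σ, D.ev s (φ m).2 = Option.some σ ∧ σ.length = p.1) ∧
      ∀ m m', m < m' → m' < M → φ m ≠ φ m' := by
  obtain ⟨T, h0, h1, h2⟩ := level_path D q p.1
  generalize (D.L q p.1).1 = l at *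
  have mono : ∀ x y, x ≤ y → y ≤ l → T x ≤ T y := by
    intro x y hxy
    induction y, hxy using Nat.le_induction with
    | base => intro _; exact le_rfl
    | succ y _ ih => intro h; exact (ih (by omega)).trans (h2 y (by omega)).1.le
  have key : ∀ m, m < M → ∃ z : ℕ × ℕ, z.1 < D.k ∧ D.len z.2 ≤ p.2 + D.C ∧
      D.ev (T (D.k * (m + 1))) z.2 = Option.some (D.b z.1 (T (D.k * (m + 1))) p.1) := by
    intro m hm
    have hle : D.k * (m + 1) ≤ D.k * M := Nat.mul_le_mul_left _ hm
    have hpos : 0 < D.k * (m + 1) := Nat.mul_pos hk (by omega)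
    obtain ⟨a1, a2, a3, a4, a5⟩ := h2 (D.k * (m + 1) - 1) (by omega)
    rw [Nat.sub_add_cancel hpos] at a2 a3
    have hm := D.E_mono (show p.1 + 1 ≤ T (D.k * (m + 1)) by omega) (p := p)
      (by rw [(D.E_mem hp).2]; exact List.mem_cons_self)
    obtain ⟨i, hi, e, _, he, hv⟩ := (resp_iff _ _ _ _ _ _ _).1 a2 p hm
    exact ⟨(i, e), hi, he, hv⟩
  choose! φ hφ1 hφ2 hφ3 using key
  refine ⟨φ, fun m hm => ⟨hφ1 m hm, hφ2 m hm, _, _, hφ3 m hm, (S.app _).length _ _⟩, ?_⟩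
  intro m m' hmm hm' heq
  have e1 := hφ3 m (by omega)
  have e2 := hφ3 m' hm'
  have hi := hφ1 m (by omega)
  rw [← heq] at e2
  generalize (φ m).1 = i at *
  have hle1 : D.k * (m + 2) ≤ D.k * (m' + 1) := Nat.mul_le_mul_left _ (by omega)
  have hle2 : D.k * (m' + 1) ≤ D.k * M := Nat.mul_le_mul_left _ (by omega)
  have hexp : D.k * (m + 2) = D.k * (m + 1) + D.k := by ring
  have e3 := S.pres.mono (mono (D.k * (m + 1)) (D.k * (m' + 1)) (by omega) (by omega)) e1
  rw [e3] at e2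
  have e4 := Option.some.inj e2
  have hb := (h2 (D.k * (m + 1) + i) (by omega)).2.2.2.2
  have hbi : D.b (D.k * (m + 1) + i) = D.b i := by
    rw [← hper, Nat.mul_add_mod, Nat.mod_eq_of_lt hi]
  rw [hbi] at hb
  apply hb
  rw [(S.app i).sand (mono (D.k * (m + 1)) (D.k * (m + 1) + i) (by omega) (by omega))
      (mono (D.k * (m + 1) + i) (D.k * (m' + 1)) (by omega) (by omega)) e4,
    (S.app i).sand (mono (D.k * (m + 1)) (D.k * (m + 1) + i + 1) (by omega) (by omega))
      (mono (D.k * (m + 1) + i + 1) (D.k * (m' + 1)) (by omega) (by omega)) e4]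

theorem absurd_setup (S : Setup U X D) (hk : 0 < D.k) (hper : ∀ j, D.b (j % D.k) = D.b j) :
    False := by
  obtain ⟨t, N, -, -, -, hE, hm, -⟩ := big_all S (JJ D.k D.C) 0 1 3 [] (D.St_zero) (by
    rw [D.E_zero, mass_nil]; norm_num [hp])
  rw [D.E_zero, List.append_nil] at hE
  subst hE
  set M := 2 ^ (D.C + 1) * (D.k + 1) with hM
  set G := D.F (t + 1) (JJ D.k D.C) (D.E (t + 1)) with hG
  have hGm : ∀ p ∈ G, p ∈ D.E (t + 1) ∧ D.k * M ≤ (D.L (t + 1) p.1).1 := fun p hp => by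
    have := D.mem_F.1 hp
    exact this
  have hnd : G.Nodup := (D.E_nodup (t + 1)).filter _
  have hc := fun p (hp : p ∈ G) => certs S hk hper (hGm p hp).1 (hGm p hp).2
  choose! φ hφ1 hφ2 using hc
  let P : Finset ((ℕ × ℕ) × ℕ) := G.toFinset ×ˢ Finset.range M
  let f : (ℕ × ℕ) × ℕ → ℕ × ℕ := fun x => φ x.1 x.2
  have hP : ∀ x, x ∈ P ↔ x.1 ∈ G ∧ x.2 < M := fun x => by simp [P]
  have hinj : Set.InjOn f (P : Set ((ℕ × ℕ) × ℕ)) := by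
    rintro ⟨p, m⟩ hx ⟨p', m'⟩ hx' heq
    obtain ⟨hp, hm1⟩ := (hP _).1 (Finset.mem_coe.1 hx)
    obtain ⟨hp', hm1'⟩ := (hP _).1 (Finset.mem_coe.1 hx')
    simp only [f] at *
    obtain ⟨-, -, s, σ, hs, hσ⟩ := hφ1 p hp m hm1
    obtain ⟨-, -, s', σ', hs', hσ'⟩ := hφ1 p' hp' m' hm1'
    rw [← heq] at hs'
    have a1 := S.pres.mono (le_max_left s s') hs
    have a2 := S.pres.mono (le_max_right s s') hs'
    rw [a1] at a2
    have a3 : p = p' := D.E_inj (hGm p hp).1 (hGm p' hp').1 (by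
      rw [← hσ, ← hσ', Option.some.inj a2])
    subst a3
    rcases lt_trichotomy m m' with h | h | h
    · exact absurd heq (hφ2 p hp m m' h hm1')
    · rw [h]
    · exact absurd heq.symm (hφ2 p hp m' m h hm1)
  let Q : Finset ℕ := (P.image f).image Prod.snd
  have hQ : ∑ e ∈ Q, hp (D.len e) ≤ 1 := by
    refine S.pres.kraft Q fun e he => ?_
    simp only [Q, Finset.mem_image] at he
    obtain ⟨y, ⟨x, hx, rfl⟩, rfl⟩ := he
    obtain ⟨h1, h2⟩ := (hP _).1 hx
    obtain ⟨-, -, s, σ, hs, hσ⟩ := hφ1 _ h1 _ h2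
    exact ⟨s, σ, hs⟩
  have u1 : ∑ x ∈ P, hp (D.len (f x).2) ≤ D.k := by
    rw [← Finset.sum_image (f := fun y : ℕ × ℕ => hp (D.len y.2)) hinj]
    have hsub : P.image f ⊆ Finset.range D.k ×ˢ Q := by
      intro y hy
      rw [Finset.mem_product]
      refine ⟨?_, Finset.mem_image_of_mem _ hy⟩
      obtain ⟨x, hx, rfl⟩ := Finset.mem_image.1 hy
      obtain ⟨h1, h2⟩ := (hP _).1 hx
      exact Finset.mem_range.2 (hφ1 _ h1 _ h2).1
    refine (Finset.sum_le_sum_of_subset_of_nonneg hsub fun _ _ _ => hp_nonneg _).trans ?_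
    rw [Finset.sum_product]
    simp only [Finset.sum_const, Finset.card_range, nsmul_eq_mul]
    have : (0 : ℝ) ≤ D.k := by positivity
    nlinarith
  have u2 : ∑ x ∈ P, hp (x.1.2 + D.C) ≤ ∑ x ∈ P, hp (D.len (f x).2) := by
    refine Finset.sum_le_sum fun x hx => ?_
    obtain ⟨h1, h2⟩ := (hP _).1 hx
    exact hp_anti (hφ1 _ h1 _ h2).2.1
  have u3 : ∑ x ∈ P, hp (x.1.2 + D.C) = M * hp D.C * mass G := by
    simp only [P]
    rw [Finset.sum_product]
    simp only [Finset.sum_const, Finset.card_range, nsmul_eq_mul, hp_add]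
    rw [List.sum_toFinset _ hnd, mass, ← sum_map_mul]
    congr 2
    funext p
    ring
  have u4 : (M : ℝ) * hp D.C = 2 * (D.k + 1) := by
    rw [hM]; push_cast
    rw [pow_succ]
    linear_combination 2 * ((D.k : ℝ) + 1) * hp_mul_pow D.C
  have hm' : 1 / 2 ≤ mass G := by simpa [hp] using hm
  rw [u3, u4] at u2
  have : (0 : ℝ) ≤ D.k := by positivity
  nlinarith

end P9

section P10

lemma zeroStr_primrec : Primrec zeroStr := by
  have h : Primrec fun n : ℕ => (List.range n).map fun _ => false :=
    Primrec.list_map Primrec.list_range (Primrec.const false).to₂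
  exact h.of_eq fun n => by simp [zeroStr]

section final
variable (k : ℕ) (ev : ℕ → ℕ → Option Str) (len : ℕ → ℕ) (b : ℕ → ℕ → ℕ → Str) (c : ℕ)

/-- the machine with parameter `d` -/
def mach (d : ℕ) : Mach := ⟨k, ev, len, b, 2 * d + 1 + c⟩

/-- all requests describing the numbers enumerated by the machines -/
def reqN (d q : ℕ) : Option (ℕ × Str) :=
  bif eqN ((mach k ev len b c d).E (q + 1)).length ((mach k ev len b c d).E q).length then
    Option.none
  else ((mach k ev len b c d).E (q + 1)).head?.map fun p => (p.2 + d + 1, zeroStr p.1)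

variable {k ev len b c}

lemma reqN_primrec (hev : Primrec₂ ev) (hlen : Primrec len)
    (hb : Primrec fun p : ℕ × ℕ × ℕ => b p.1 p.2.1 p.2.2) : Primrec₂ (reqN k ev len b c) := by
  have hC : Primrec fun x : ℕ × ℕ => 2 * x.1 + 1 + c :=
    Primrec.nat_add.comp (Primrec.nat_add.comp (Primrec.nat_mul.comp (Primrec.const 2) Primrec.fst)
      (Primrec.const 1)) (Primrec.const c)
  have hE : Primrec fun x : ℕ × ℕ => (mach k ev len b c x.1).E x.2 := by
    have h := (conf_primrec (k := k) hev hlen hb).comp hC Primrec.snd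
    exact Primrec.fst.comp (Primrec.snd.comp (Primrec.snd.comp h))
  have hE' : Primrec fun x : ℕ × ℕ => (mach k ev len b c x.1).E (x.2 + 1) := by
    have h := hE.comp (Primrec.pair (Primrec.fst (α := ℕ) (β := ℕ))
      (Primrec.succ.comp Primrec.snd))
    exact h
  have c1 := eqN_primrec.comp (Primrec.list_length.comp hE') (Primrec.list_length.comp hE)
  have d1 := Primrec.list_head?.comp hE'
  have m1 : Primrec₂ fun (x : ℕ × ℕ) (p : ℕ × ℕ) => (p.2 + x.1 + 1, zeroStr p.1) := by
    have a1 : Primrec fun z : (ℕ × ℕ) × (ℕ × ℕ) => z.2.2 := Primrec.snd.comp Primrec.snd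
    have a2 : Primrec fun z : (ℕ × ℕ) × (ℕ × ℕ) => z.1.1 := Primrec.fst.comp Primrec.fst
    have a3 : Primrec fun z : (ℕ × ℕ) × (ℕ × ℕ) => z.2.1 := Primrec.fst.comp Primrec.snd
    have a4 := Primrec.pair (Primrec.succ.comp (Primrec.nat_add.comp a1 a2))
      (zeroStr_primrec.comp a3)
    exact a4
  have d2 := Primrec.option_map d1 m1
  exact Primrec.cond c1 (Primrec.const _) d2

lemma wt_reqN (d q) : wt (reqN k ev len b c d q) ≤
    hp (d + 1) * (mass ((mach k ev len b c d).E (q + 1)) - mass ((mach k ev len b c d).E q)) := by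
  unfold reqN
  rcases (mach k ev len b c d).E_step q with h | ⟨g, h, -⟩
  · rw [h]; simp [eqN, wt]
  · rw [h, mass_cons]
    simp only [eqN, List.length_cons, List.head?_cons, Option.map_some]
    rw [add_sub_cancel_right, ← hp_add]
    have e : d + 1 + g = g + d + 1 := by omega
    rw [e]
    simp [wt]

lemma geo_one (n : ℕ) : ∑ i ∈ Finset.range n, hp (i + 1) = 1 - hp n := by
  induction n with
  | zero => simp [hp]
  | succ n ih => rw [Finset.sum_range_succ, ih, hp_succ n]; ring

lemma sum_reqN (N : ℕ) :
    ∑ i ∈ Finset.range N, wt (reqN k ev len b c i.unpair.1 i.unpair.2) ≤ 1 := by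
  have h1 : ∑ i ∈ Finset.range N, wt (reqN k ev len b c i.unpair.1 i.unpair.2) =
      ∑ x ∈ (Finset.range N).image Nat.unpair, wt (reqN k ev len b c x.1 x.2) := by
    rw [Finset.sum_image]
    intro x _ y _ h
    rw [← Nat.pair_unpair x, h, Nat.pair_unpair]
  have hsub : (Finset.range N).image Nat.unpair ⊆ Finset.range N ×ˢ Finset.range N := by
    intro x hx
    obtain ⟨i, hi, rfl⟩ := Finset.mem_image.1 hx
    have a1 := Nat.unpair_left_le i
    have a2 := Nat.unpair_right_le i
    simp only [Finset.mem_product, Finset.mem_range] at hi ⊢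
    omega
  rw [h1]
  refine (Finset.sum_le_sum_of_subset_of_nonneg hsub fun _ _ _ => wt_nonneg _).trans ?_
  rw [Finset.sum_product]
  have h2 : ∀ d ∈ Finset.range N, ∑ q ∈ Finset.range N, wt (reqN k ev len b c d q) ≤ hp (d + 1) := by
    intro d _
    refine (Finset.sum_le_sum fun q _ => wt_reqN d q).trans ?_
    rw [← Finset.mul_sum, Finset.sum_range_sub (fun q => mass ((mach k ev len b c d).E q)),
      Mach.E_zero, mass_nil, sub_zero]
    have := (mach k ev len b c d).E_mass N
    nlinarith [hp_pos (d + 1)]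
  refine (Finset.sum_le_sum h2).trans ?_
  rw [geo_one]
  linarith [hp_pos N]

end final

theorem main_aux (U : Str →. Str) (hU : OptimalPF U) (k : ℕ) (hk : 0 < k) (X : ℕ → ℕ → Bool)
    (hX : ∀ i < k, CEReal (X i)) (hnt : ∀ i < k, ¬ KTrivialSeq U (X i)) (c : ℕ)
    (hc : ∀ n, ∃ i < k, KC U (restrSeq (X i) n) ≤ KC U (zeroStr n) + c) : False := by
  obtain ⟨ev, len, hp⟩ := exists_pres U hU.1
  obtain ⟨b0, hb0, hap⟩ := exists_approx_fin k X hX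
  let b : ℕ → ℕ → ℕ → Str := fun j => b0 (j % k)
  have hb : Primrec fun p : ℕ × ℕ × ℕ => b p.1 p.2.1 p.2.2 := by
    have h := hb0.comp (Primrec.pair (Primrec.nat_mod.comp (Primrec.fst (α := ℕ) (β := ℕ × ℕ))
      (Primrec.const k)) Primrec.snd)
    exact h
  have hR := reqN_primrec (k := k) (c := c) hp.pev hp.plen hb
  have hR' := hR.comp (Primrec.fst.comp Primrec.unpair) (Primrec.snd.comp Primrec.unpair)
  obtain ⟨β, hβ⟩ := kc_lemma hU _ hR'.to_comp sum_reqN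
  have S : Setup U (fun j => X (j % k)) (mach k ev len b c β) := by
    refine ⟨hU, hp, hb, fun j => hap _ (Nat.mod_lt _ hk), fun j => hnt _ (Nat.mod_lt _ hk), ?_⟩
    intro q p hpq
    obtain ⟨-, hE⟩ := (mach k ev len b c β).E_mem hpq
    obtain ⟨i, hi, hKi⟩ := hc p.1
    refine ⟨i, hi, ?_⟩
    have hreq : reqN k ev len b c β p.1 = Option.some (p.2 + β + 1, zeroStr p.1) := by
      simp [reqN, hE, eqN]
    have h1 := hβ (Nat.pair β p.1) (p.2 + β + 1) (zeroStr p.1) (by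
      rw [Nat.unpair_pair]; exact hreq)
    simp only [Nat.mod_eq_of_lt hi]
    refine hKi.trans ((add_le_add_left h1 _).trans ?_)
    simp only [mach]
    norm_cast
    omega
  exact absurd_setup S hk fun j => by simp [mach, b]


end P10

/-- If `A_0, …, A_{k-1}` are c.e. reals, none `K`-trivial, then for
every constant `c` there is an `n` with `K(A_i↾n) > K(n) + c` for all `i < k`. -/
theorem stmt11 (U : Str →. Str) (hU : OptimalPF U)
    (k : ℕ) (A : Fin k → (ℕ → Bool)) (hA : ∀ i, CEReal (A i))
    (hAnt : ∀ i, ¬ KTrivialSeq U (A i)) :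
    ∀ c : ℕ, ∃ n : ℕ, ∀ i, KC U (zeroStr n) + c < KC U (restrSeq (A i) n) := by
  intro c
  rcases Nat.eq_zero_or_pos k with rfl | hk
  · exact ⟨0, fun i => i.elim0⟩
  by_contra hcon
  push Not at hcon
  have hval : ∀ i (hi : i < k), (if h : i < k then A ⟨i, h⟩ else A ⟨0, hk⟩) = A ⟨i, hi⟩ :=
    fun i hi => by rw [dif_pos hi]
  refine main_aux U hU k hk (fun i => if h : i < k then A ⟨i, h⟩ else A ⟨0, hk⟩) ?_ ?_ c ?_
  · intro i hi
    simp only [hval i hi]; exact hA _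
  · intro i hi
    simp only [hval i hi]; exact hAnt _
  · intro n
    obtain ⟨i, hi⟩ := hcon n
    refine ⟨i, i.2, ?_⟩
    simp only [hval i i.2]; exact hi

end KPaper
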